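/- arXiv:2505.17668 — 13 statements merged into one kernel-verified Lean document; each statement's English description precedes it below -/
import Mathlib

section
/- Let q : ℝ → ℝ be continuous, and let u, v : ℝ → ℝ be compactly supported functions that are twice continuously differentiable on (-∞,0] and on [0,∞) separately (with one-sided limits of the functions and their first derivatives at 0). Then ∫_{ℝ∖{0}} [(-u''(x) + q(x)u(x)) v(x) − u(x) (-v''(x) + q(x)v(x))] dx = ⟨Γ₁u, Γ₀v⟩_{ℝ²} − ⟨Γ₀u, Γ₁v⟩_{ℝ²} (the abstract second Green identity for the Schrödinger expression with the boundary operators at the origin). -/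
open MeasureTheory Set Filter Topology

/-- Boundary operator `Γ₀` expressed through the one-sided limit data
`(w₊, w₋, w'₊, w'₋)` at the origin: `Γ₀w = (w₊ − w₋, w'₊ − w'₋)`. -/
def Gamma0 (wp wm w'p w'm : ℝ) : ℝ × ℝ := (wp - wm, w'p - w'm)

/-- Boundary operator `Γ₁` expressed through the one-sided limit data
`(w₊, w₋, w'₊, w'₋)` at the origin: `Γ₁w = ((w'₊ + w'₋)/2, −(w₊ + w₋)/2)`. -/
noncomputable def Gamma1 (wp wm w'p w'm : ℝ) : ℝ × ℝ := ((w'p + w'm) / 2, -(wp + wm) / 2)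

/-- The Euclidean inner product on `ℝ²`. -/
def dot2 (a b : ℝ × ℝ) : ℝ := a.1 * b.1 + a.2 * b.2

/-- A function that is continuous on `(0, ∞)`, has a right limit at `0` and has compact support is
integrable on `(0, ∞)`. -/
theorem HasCompactSupport.integrableOn_Ioi_of_tendsto {f : ℝ → ℝ} {b : ℝ}
    (hf : HasCompactSupport f) (hcont : ContinuousOn f (Ioi 0))
    (hb : Tendsto f (𝓝[>] 0) (𝓝 b)) : IntegrableOn f (Ioi 0) := by
  have hext : ContinuousOn (Function.update f 0 b) (Ici 0) := by
    rw [continuousOn_update_iff, Ici_sdiff_left]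
    exact ⟨hcont, fun _ => hb⟩
  have hcompact : IntegrableOn (Function.update f 0 b) (tsupport f ∩ Ici 0) :=
    (hext.mono inter_subset_right).integrableOn_compact (hf.inter_right isClosed_Ici)
  have hmeas : MeasurableSet (tsupport f ∩ Ioi 0) :=
    (isClosed_tsupport f).measurableSet.inter measurableSet_Ioi
  have hpos : IntegrableOn f (tsupport f ∩ Ioi 0) := by
    refine (hcompact.mono_set (inter_subset_inter_right _ Ioi_subset_Ici_self)).congr_fun ?_ hmeas
    intro x hx
    exact Function.update_of_ne (ne_of_gt hx.2) _ _
  refine hpos.of_forall_sdiff_eq_zero measurableSet_Ioi fun x hx => ?_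
  exact image_eq_zero_of_notMem_tsupport fun h => hx.2 ⟨h, hx.1⟩

/-- The fundamental theorem of calculus on `(0, ∞)` for a compactly supported function, in terms of
its right limit at `0`. -/
theorem HasCompactSupport.integral_Ioi_deriv_of_tendsto {f f' : ℝ → ℝ} {a b : ℝ}
    (hf : HasCompactSupport f) (hf' : HasCompactSupport f')
    (hderiv : ∀ x ∈ Ioi (0 : ℝ), HasDerivAt f (f' x) x) (hcont : ContinuousOn f' (Ioi 0))
    (ha : Tendsto f (𝓝[>] 0) (𝓝 a)) (hb : Tendsto f' (𝓝[>] 0) (𝓝 b)) :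
    ∫ x in Ioi (0 : ℝ), f' x = -a := by
  have hext : ContinuousWithinAt (Function.update f 0 a) (Ici 0) 0 := by
    rw [continuousWithinAt_update_same, Ici_sdiff_left]
    exact ha
  have hext_deriv : ∀ x ∈ Ioi (0 : ℝ), HasDerivAt (Function.update f 0 a) (f' x) x := by
    intro x hx
    refine (hderiv x hx).congr_of_eventuallyEq ?_
    filter_upwards [isOpen_Ioi.mem_nhds hx] with y hy
    exact Function.update_of_ne (ne_of_gt hy) _ _
  have hlim : Tendsto (Function.update f 0 a) atTop (𝓝 0) := by
    refine (hf.is_zero_at_infty.mono_left atTop_le_cocompact).congr' ?_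
    filter_upwards [eventually_gt_atTop 0] with y hy
    exact (Function.update_of_ne (ne_of_gt hy) _ _).symm
  simpa using integral_Ioi_of_hasDerivAt_of_tendsto hext hext_deriv
    (hf'.integrableOn_Ioi_of_tendsto hcont hb) hlim

theorem tendsto_neg_nhdsGT_zero : Tendsto (fun x : ℝ => -x) (𝓝[>] 0) (𝓝[<] 0) := by
  simpa using tendsto_neg_nhdsGT (a := (0 : ℝ))

theorem mapsTo_neg_Ioi_zero : MapsTo (fun x : ℝ => -x) (Ioi 0) (Iio 0) :=
  fun _ hx => neg_lt_zero.2 (mem_Ioi.1 hx)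

theorem HasCompactSupport.comp_neg_real {f : ℝ → ℝ} (hf : HasCompactSupport f) :
    HasCompactSupport fun x => f (-x) :=
  hf.comp_homeomorph (Homeomorph.neg ℝ)

/-- A function that is continuous on `(-∞, 0)`, has a left limit at `0` and has compact support is
integrable on `(-∞, 0)`. -/
theorem HasCompactSupport.integrableOn_Iio_of_tendsto {f : ℝ → ℝ} {b : ℝ}
    (hf : HasCompactSupport f) (hcont : ContinuousOn f (Iio 0))
    (hb : Tendsto f (𝓝[<] 0) (𝓝 b)) : IntegrableOn f (Iio 0) := by
  have h : IntegrableOn (fun x => f (-x)) (Ioi 0) :=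
    hf.comp_neg_real.integrableOn_Ioi_of_tendsto
      (hcont.comp continuousOn_neg mapsTo_neg_Ioi_zero) (hb.comp tendsto_neg_nhdsGT_zero)
  rw [← (Measure.measurePreserving_neg (volume : Measure ℝ)).integrableOn_comp_preimage
    (Homeomorph.neg ℝ).measurableEmbedding]
  simpa [Function.comp_def] using h

/-- The fundamental theorem of calculus on `(-∞, 0)` for a compactly supported function, in terms
of its left limit at `0`. -/
theorem HasCompactSupport.integral_Iio_deriv_of_tendsto {f f' : ℝ → ℝ} {a b : ℝ}
    (hf : HasCompactSupport f) (hf' : HasCompactSupport f')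
    (hderiv : ∀ x ∈ Iio (0 : ℝ), HasDerivAt f (f' x) x) (hcont : ContinuousOn f' (Iio 0))
    (ha : Tendsto f (𝓝[<] 0) (𝓝 a)) (hb : Tendsto f' (𝓝[<] 0) (𝓝 b)) :
    ∫ x in Iio (0 : ℝ), f' x = a := by
  have h := HasCompactSupport.integral_Ioi_deriv_of_tendsto (f := fun x => f (-x))
    (f' := fun x => -f' (-x)) hf.comp_neg_real hf'.comp_neg_real.neg
    (fun x hx => by
      simpa using! (hderiv (-x) (mapsTo_neg_Ioi_zero hx)).comp x (hasDerivAt_neg x))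
    (hcont.comp continuousOn_neg mapsTo_neg_Ioi_zero).neg
    (ha.comp tendsto_neg_nhdsGT_zero) (hb.comp tendsto_neg_nhdsGT_zero).neg
  rw [integral_neg, integral_comp_neg_Ioi, neg_zero, integral_Iic_eq_integral_Iio] at h
  exact neg_injective h

theorem ContDiffOn.continuousOn_deriv_deriv {f : ℝ → ℝ} {s : Set ℝ} (hf : ContDiffOn ℝ 2 f s)
    (hs : IsOpen s) : ContinuousOn (deriv (deriv f)) s :=
  (hf.deriv_of_isOpen (m := 1) hs (by norm_num)).continuousOn_deriv_of_isOpen hs le_rfl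

/-- The Wronskian `u v' - u' v` has derivative `u v'' - u'' v`. -/
theorem ContDiffOn.hasDerivAt_wronskian {u v : ℝ → ℝ} {s : Set ℝ} (hu : ContDiffOn ℝ 2 u s)
    (hv : ContDiffOn ℝ 2 v s) (hs : IsOpen s) {x : ℝ} (hx : x ∈ s) :
    HasDerivAt (fun y => u y * deriv v y - deriv u y * v y)
      (u x * deriv (deriv v) x - deriv (deriv u) x * v x) x := by
  have h1 {w : ℝ → ℝ} (hw : ContDiffOn ℝ 2 w s) : HasDerivAt w (deriv w x) x :=
    ((hw.differentiableOn (by norm_num)).differentiableAt (hs.mem_nhds hx)).hasDerivAt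
  have h2 {w : ℝ → ℝ} (hw : ContDiffOn ℝ 2 w s) : HasDerivAt (deriv w) (deriv (deriv w) x) x :=
    (((hw.deriv_of_isOpen (m := 1) hs (by norm_num)).differentiableOn
      (by norm_num)).differentiableAt (hs.mem_nhds hx)).hasDerivAt
  exact (((h1 hu).mul (h2 hv)).sub ((h2 hu).mul (h1 hv))).congr_deriv (by ring)

theorem ContDiffOn.continuousOn_deriv_wronskian {u v : ℝ → ℝ} {s : Set ℝ}
    (hu : ContDiffOn ℝ 2 u s) (hv : ContDiffOn ℝ 2 v s) (hs : IsOpen s) :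
    ContinuousOn (fun x => u x * deriv (deriv v) x - deriv (deriv u) x * v x) s :=
  (hu.continuousOn.mul (hv.continuousOn_deriv_deriv hs)).sub
    ((hu.continuousOn_deriv_deriv hs).mul hv.continuousOn)

/-- The abstract second Green identity for the Schrödinger expression
`-w'' + q w` on the real line with boundary operators at the origin. -/
theorem stmt0 (q u v : ℝ → ℝ) (hq : Continuous q)
    (hu : HasCompactSupport u) (hv : HasCompactSupport v)
    -- `u`, `v` are twice continuously differentiable on `(-∞,0]` and `[0,∞)` separately:
    (huL : ContDiffOn ℝ 2 u (Iio 0)) (huR : ContDiffOn ℝ 2 u (Ioi 0))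
    (hvL : ContDiffOn ℝ 2 v (Iio 0)) (hvR : ContDiffOn ℝ 2 v (Ioi 0))
    (up um u'p u'm u''p u''m vp vm v'p v'm v''p v''m : ℝ)
    -- one-sided limits at the origin of `u`, `u'`, `u''` and of `v`, `v'`, `v''`:
    (hup : Tendsto u (𝓝[>] 0) (𝓝 up)) (hum : Tendsto u (𝓝[<] 0) (𝓝 um))
    (hu'p : Tendsto (deriv u) (𝓝[>] 0) (𝓝 u'p))
    (hu'm : Tendsto (deriv u) (𝓝[<] 0) (𝓝 u'm))
    (hu''p : Tendsto (deriv (deriv u)) (𝓝[>] 0) (𝓝 u''p))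
    (hu''m : Tendsto (deriv (deriv u)) (𝓝[<] 0) (𝓝 u''m))
    (hvp : Tendsto v (𝓝[>] 0) (𝓝 vp)) (hvm : Tendsto v (𝓝[<] 0) (𝓝 vm))
    (hv'p : Tendsto (deriv v) (𝓝[>] 0) (𝓝 v'p))
    (hv'm : Tendsto (deriv v) (𝓝[<] 0) (𝓝 v'm))
    (hv''p : Tendsto (deriv (deriv v)) (𝓝[>] 0) (𝓝 v''p))
    (hv''m : Tendsto (deriv (deriv v)) (𝓝[<] 0) (𝓝 v''m)) :
    ∫ x in ({0}ᶜ : Set ℝ),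
        ((-(deriv (deriv u) x) + q x * u x) * v x
          - u x * (-(deriv (deriv v) x) + q x * v x))
      = dot2 (Gamma1 up um u'p u'm) (Gamma0 vp vm v'p v'm)
        - dot2 (Gamma0 up um u'p u'm) (Gamma1 vp vm v'p v'm) := by
  have hW : HasCompactSupport fun x => u x * deriv v x - deriv u x * v x :=
    hu.mul_right.sub hv.mul_left
  have hW' : HasCompactSupport fun x => u x * deriv (deriv v) x - deriv (deriv u) x * v x :=
    hu.mul_right.sub hv.mul_left
  have hcontR := huR.continuousOn_deriv_wronskian hvR isOpen_Ioi
  have hcontL := huL.continuousOn_deriv_wronskian hvL isOpen_Iio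
  have hlimR := (hup.mul hv''p).sub (hu''p.mul hvp)
  have hlimL := (hum.mul hv''m).sub (hu''m.mul hvm)
  have hR := hW.integral_Ioi_deriv_of_tendsto hW'
    (fun x hx => huR.hasDerivAt_wronskian hvR isOpen_Ioi hx) hcontR
    ((hup.mul hv'p).sub (hu'p.mul hvp)) hlimR
  have hL := hW.integral_Iio_deriv_of_tendsto hW'
    (fun x hx => huL.hasDerivAt_wronskian hvL isOpen_Iio hx) hcontL
    ((hum.mul hv'm).sub (hu'm.mul hvm)) hlimL
  have hintegrand : ∀ x, (-(deriv (deriv u) x) + q x * u x) * v x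
      - u x * (-(deriv (deriv v) x) + q x * v x)
        = u x * deriv (deriv v) x - deriv (deriv u) x * v x := fun x => by ring
  simp_rw [hintegrand]
  rw [← Iio_union_Ioi, setIntegral_union Ioi_disjoint_Iio_same.symm measurableSet_Ioi
    (hW'.integrableOn_Iio_of_tendsto hcontL hlimL) (hW'.integrableOn_Ioi_of_tendsto hcontR hlimR),
    hL, hR]
  simp only [dot2, Gamma0, Gamma1]
  ring
end

section
/- Let f₁, f₂ : ℝ → ℝ be smooth functions vanishing on (-∞,0]. Define u : (ℝ∖{0}) × ℝ → ℝ by u(x,t) = (1/2)f₁(t−x) − (1/2)f₂(t−x) for x > 0 and u(x,t) = −(1/2)f₁(t+x) − (1/2)f₂(t+x) for x < 0. Then: (i) u is smooth on each of {x>0} and {x<0} and satisfies u_tt(x,t) = u_xx(x,t) there; (ii) u(x,t) = 0 whenever t < |x|, and in particular u(x,0) = u_t(x,0) = 0 for all x ≠ 0; (iii) for every t, the one-sided limits at x = 0 satisfy u(0⁺,t) − u(0⁻,t) = f₁(t) and u_x(0⁺,t) − u_x(0⁻,t) = f₂'(t), i.e. Γ₀u(·,t) = (f₁(t), f₂'(t)).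 -/
open Set Filter Topology

theorem deriv_deriv_eventuallyEq {g h : ℝ → ℝ} {x : ℝ} (hgh : g =ᶠ[𝓝 x] h) :
    deriv (fun y => deriv g y) x = deriv (fun y => deriv h y) x :=
  hgh.deriv.deriv_eq

/-- The explicit solution of the free (`q = 0`) wave equation on the line with
boundary control `(f₁, f₂)` acting at the origin: smoothness and the wave equation
on `{x > 0}` and `{x < 0}`, vanishing for `t < |x|` (hence zero Cauchy data), and
the jump conditions `Γ₀u(·,t) = (f₁(t), f₂'(t))` at the origin. -/
theorem stmt1 (f₁ f₂ : ℝ → ℝ)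
    (hf₁ : ContDiff ℝ (⊤ : ℕ∞) f₁) (hf₂ : ContDiff ℝ (⊤ : ℕ∞) f₂)
    (hf₁0 : ∀ t ≤ (0 : ℝ), f₁ t = 0) (hf₂0 : ∀ t ≤ (0 : ℝ), f₂ t = 0)
    (u : ℝ → ℝ → ℝ)
    (hu : ∀ x t, u x t =
      if 0 < x then (1 / 2) * f₁ (t - x) - (1 / 2) * f₂ (t - x)
      else -(1 / 2) * f₁ (t + x) - (1 / 2) * f₂ (t + x)) :
    -- (i) smoothness on each half-plane and the wave equation `u_tt = u_xx` there
    (ContDiffOn ℝ (⊤ : ℕ∞) (fun p : ℝ × ℝ => u p.1 p.2) {p : ℝ × ℝ | 0 < p.1} ∧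
     ContDiffOn ℝ (⊤ : ℕ∞) (fun p : ℝ × ℝ => u p.1 p.2) {p : ℝ × ℝ | p.1 < 0} ∧
     ∀ x t : ℝ, x ≠ 0 →
       deriv (fun τ => deriv (fun σ => u x σ) τ) t
         = deriv (fun y => deriv (fun z => u z t) y) x) ∧
    -- (ii) vanishing ahead of the wave front, and zero initial data
    ((∀ x t : ℝ, t < |x| → u x t = 0) ∧
     ∀ x : ℝ, x ≠ 0 → u x 0 = 0 ∧ deriv (fun τ => u x τ) 0 = 0) ∧
    -- (iii) the jump conditions at `x = 0`: `Γ₀u(·,t) = (f₁(t), f₂'(t))`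
    (∀ t : ℝ, ∃ a b c d : ℝ,
      Tendsto (fun x => u x t) (𝓝[>] 0) (𝓝 a) ∧
      Tendsto (fun x => u x t) (𝓝[<] 0) (𝓝 b) ∧
      Tendsto (fun x => deriv (fun z => u z t) x) (𝓝[>] 0) (𝓝 c) ∧
      Tendsto (fun x => deriv (fun z => u z t) x) (𝓝[<] 0) (𝓝 d) ∧
      a - b = f₁ t ∧ c - d = deriv f₂ t) := by
  obtain ⟨F, hF⟩ : ∃ F : ℝ → ℝ, F = fun s => (1 / 2) * f₁ s - (1 / 2) * f₂ s := ⟨_, rfl⟩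
  obtain ⟨G, hG⟩ : ∃ G : ℝ → ℝ, G = fun s => -(1 / 2) * f₁ s - (1 / 2) * f₂ s := ⟨_, rfl⟩
  have hFs : ContDiff ℝ (⊤ : ℕ∞) F := by subst hF; fun_prop
  have hGs : ContDiff ℝ (⊤ : ℕ∞) G := by subst hG; fun_prop
  have hpos : ∀ x t, 0 < x → u x t = F (t - x) := fun x t hx => by simp [hu, hx, hF]
  have hneg : ∀ x t, x < 0 → u x t = G (t + x) := fun x t hx => by simp [hu, hx.not_gt, hG]
  have hposx : ∀ x t, 0 < x → (fun z => u z t) =ᶠ[𝓝 x] fun z => F (t - z) := fun x t hx => by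
    filter_upwards [lt_mem_nhds hx] with z hz using hpos z t hz
  have hnegx : ∀ x t, x < 0 → (fun z => u z t) =ᶠ[𝓝 x] fun z => G (t + z) := fun x t hx => by
    filter_upwards [gt_mem_nhds hx] with z hz using hneg z t hz
  have hzero : ∀ x t : ℝ, t < |x| → u x t = 0 := fun x t ht => by
    rw [hu]
    split_ifs with hx
    · rw [abs_of_pos hx] at ht
      simp [hf₁0 (t - x) (by linarith), hf₂0 (t - x) (by linarith)]
    · rw [abs_of_nonpos (not_lt.mp hx)] at ht
      simp [hf₁0 (t + x) (by linarith), hf₂0 (t + x) (by linarith)]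
  have hf₁d : Differentiable ℝ f₁ := hf₁.differentiable (by simp)
  have hf₂d : Differentiable ℝ f₂ := hf₂.differentiable (by simp)
  have hF' : ∀ t, deriv F t = (1 / 2) * deriv f₁ t - (1 / 2) * deriv f₂ t := fun t => by
    subst hF
    exact (((hf₁d t).hasDerivAt.const_mul _).sub ((hf₂d t).hasDerivAt.const_mul _)).deriv
  have hG' : ∀ t, deriv G t = -(1 / 2) * deriv f₁ t - (1 / 2) * deriv f₂ t := fun t => by
    subst hG
    exact (((hf₁d t).hasDerivAt.const_mul _).sub ((hf₂d t).hasDerivAt.const_mul _)).deriv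
  have hFc : Continuous (deriv F) := hFs.continuous_deriv (by simp)
  have hGc : Continuous (deriv G) := hGs.continuous_deriv (by simp)
  refine ⟨⟨?_, ?_, ?_⟩, ⟨hzero, ?_⟩, ?_⟩
  · exact (ContDiff.contDiffOn (by fun_prop : ContDiff ℝ (⊤ : ℕ∞)
      fun p : ℝ × ℝ => F (p.2 - p.1))).congr fun p hp => hpos p.1 p.2 hp
  · exact (ContDiff.contDiffOn (by fun_prop : ContDiff ℝ (⊤ : ℕ∞)
      fun p : ℝ × ℝ => G (p.2 + p.1))).congr fun p hp => hneg p.1 p.2 hp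
  · intro x t hx
    rcases hx.lt_or_gt with hx | hx
    · rw [deriv_deriv_eventuallyEq (hnegx x t hx), funext fun σ => hneg x σ hx]
      simp [deriv_comp_add_const, deriv_comp_const_add]
    · rw [deriv_deriv_eventuallyEq (hposx x t hx), funext fun σ => hpos x σ hx]
      simp [deriv_comp_sub_const, deriv_comp_const_sub]
  · intro x hx
    have h : (fun τ => u x τ) =ᶠ[𝓝 0] fun _ => 0 := by
      filter_upwards [gt_mem_nhds (abs_pos.mpr hx)] with τ hτ using hzero x τ hτ
    exact ⟨h.eq_of_nhds, by simp [h.deriv_eq]⟩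
  · intro t
    refine ⟨F t, G t, -deriv F t, deriv G t, ?_, ?_, ?_, ?_, ?_, ?_⟩
    · have h : Tendsto (fun x => F (t - x)) (𝓝[>] 0) (𝓝 (F (t - 0))) :=
        (hFs.continuous.comp (continuous_const.sub continuous_id)).continuousAt.mono_left
          nhdsWithin_le_nhds
      rw [sub_zero] at h
      exact h.congr' (by filter_upwards [self_mem_nhdsWithin] with x hx using (hpos x t hx).symm)
    · have h : Tendsto (fun x => G (t + x)) (𝓝[<] 0) (𝓝 (G (t + 0))) :=
        (hGs.continuous.comp (continuous_const.add continuous_id)).continuousAt.mono_left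
          nhdsWithin_le_nhds
      rw [add_zero] at h
      exact h.congr' (by filter_upwards [self_mem_nhdsWithin] with x hx using (hneg x t hx).symm)
    · have h : Tendsto (fun x => -deriv F (t - x)) (𝓝[>] 0) (𝓝 (-deriv F (t - 0))) :=
        (hFc.comp (continuous_const.sub continuous_id)).neg.continuousAt.mono_left
          nhdsWithin_le_nhds
      rw [sub_zero] at h
      refine h.congr' ?_
      filter_upwards [self_mem_nhdsWithin] with x hx
      rw [(hposx x t hx).deriv_eq, deriv_comp_const_sub]
    · have h : Tendsto (fun x => deriv G (t + x)) (𝓝[<] 0) (𝓝 (deriv G (t + 0))) :=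
        (hGc.comp (continuous_const.add continuous_id)).continuousAt.mono_left
          nhdsWithin_le_nhds
      rw [add_zero] at h
      refine h.congr' ?_
      filter_upwards [self_mem_nhdsWithin] with x hx
      rw [(hnegx x t hx).deriv_eq, deriv_comp_const_add]
    · simp only [hF, hG]; ring
    · rw [hF', hG']; ring
end

section
/- Let w : {(x,s) ∈ ℝ² : 0 ≤ x ≤ s} → ℝ be twice continuously differentiable, and let f : ℝ → ℝ be smooth with f(τ) = 0 for all τ ≤ 0. Define G(x,t) = ∫_x^t w(x,s) f(t−s) ds for 0 < x < t. Then G is twice continuously differentiable on {0 < x < t} and ∂²G/∂t²(x,t) − ∂²G/∂x²(x,t) = ∫_x^t (w_ss(x,s) − w_xx(x,s)) f(t−s) ds + 2 (d/dx)[w(x,x)] f(t−x), where (d/dx)[w(x,x)] = w_x(x,x) + w_s(x,x) is the total derivative of w along the diagonal. -/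
open Set Filter Topology intervalIntegral

section ParametricIntegral

universe u

variable {H : Type u} [NormedAddCommGroup H] [NormedSpace ℝ H] [ProperSpace H]

/-- Differentiation under the integral sign for a `C¹` integrand over a fixed interval. -/
theorem hasFDerivAt_intervalIntegral_of_contDiff {E : Type*} [NormedAddCommGroup E]
    [NormedSpace ℝ E] {F : H → ℝ → E} (hF : ContDiff ℝ 1 (Function.uncurry F)) (a b : ℝ) (x₀ : H) :
    HasFDerivAt (fun x => ∫ s in a..b, F x s) (∫ s in a..b, fderiv ℝ (fun x => F x s) x₀) x₀ := by
  have hcont : Continuous (Function.uncurry fun (x : H) (s : ℝ) => fderiv ℝ (fun x => F x s) x) :=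
    (ContDiff.fderiv (n := 0) (f := fun (p : H × ℝ) x => F x p.2) (g := Prod.fst)
      (hF.comp (by fun_prop : ContDiff ℝ 1 fun q : (H × ℝ) × H => (q.2, q.1.2)))
      contDiff_fst (by norm_num)).continuous
  obtain ⟨C, hC⟩ := ((isCompact_closedBall x₀ 1).prod (isCompact_uIcc (a := a) (b := b)))
    |>.exists_bound_of_continuousOn hcont.continuousOn
  refine hasFDerivAt_integral_of_dominated_of_fderiv_le (bound := fun _ => C)
    (F' := fun x s => fderiv ℝ (fun x => F x s) x)
    (Metric.closedBall_mem_nhds x₀ one_pos) (.of_forall fun x => ?_) ?_ ?_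
    (.of_forall fun s hs x hx => hC (x, s) ⟨hx, uIoc_subset_uIcc hs⟩) (by simp)
    (.of_forall fun s _ x _ => ?_)
  · exact (hF.continuous.uncurry_left x).aestronglyMeasurable
  · exact (hF.continuous.uncurry_left x₀).intervalIntegrable _ _
  · exact (hcont.uncurry_left x₀).aestronglyMeasurable
  · have : ContDiff ℝ 1 fun x => F x s :=
      hF.comp (by fun_prop : ContDiff ℝ 1 fun x : H => (x, s))
    exact (this.differentiable one_ne_zero x).hasFDerivAt

theorem ContDiff.intervalIntegral_param {n : ℕ} {E : Type u} [NormedAddCommGroup E]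
    [NormedSpace ℝ E] {F : H → ℝ → E} (hF : ContDiff ℝ n (Function.uncurry F)) (a b : ℝ) :
    ContDiff ℝ n fun x => ∫ s in a..b, F x s := by
  induction n generalizing E with
  | zero =>
    simp only [Nat.cast_zero, contDiff_zero] at hF ⊢
    exact continuous_parametric_intervalIntegral_of_continuous' hF a b
  | succ n ih =>
    rw [Nat.cast_succ] at hF ⊢
    refine contDiff_succ_iff_hasFDerivAt.2
      ⟨fun x => ∫ s in a..b, fderiv ℝ (fun x => F x s) x, ih ?_,
        hasFDerivAt_intervalIntegral_of_contDiff (hF.of_le (by simp)) a b⟩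
    exact ContDiff.fderiv (f := fun (p : H × ℝ) x => F x p.2) (g := Prod.fst)
      (hF.comp (by fun_prop : ContDiff ℝ (n + 1) fun q : (H × ℝ) × H => (q.2, q.1.2)))
      contDiff_fst le_rfl

theorem ContDiff.intervalIntegral_param_endpoints {n : ℕ} {E : Type u} [NormedAddCommGroup E]
    [NormedSpace ℝ E] {F : H → ℝ → E} (hF : ContDiff ℝ n (Function.uncurry F)) {a b : H → ℝ}
    (ha : ContDiff ℝ n a) (hb : ContDiff ℝ n b) :
    ContDiff ℝ n fun x => ∫ s in a x..b x, F x s := by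
  have hsubst : (fun x => ∫ s in a x..b x, F x s) =
      fun x => (b x - a x) • ∫ θ in (0 : ℝ)..1, F x (a x + (b x - a x) * θ) := by
    ext x
    rw [smul_integral_comp_add_mul]
    simp
  rw [hsubst]
  refine (hb.sub ha).smul (ContDiff.intervalIntegral_param ?_ 0 1)
  exact hF.comp (g := Function.uncurry F)
    (f := fun p : H × ℝ => (p.1, a p.1 + (b p.1 - a p.1) * p.2)) (by fun_prop)

end ParametricIntegral

section PartialDerivatives

theorem ContDiff.deriv_fst {k : ℝ → ℝ → ℝ} {n : ℕ}
    (hk : ContDiff ℝ (n + 1) (Function.uncurry k)) :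
    ContDiff ℝ n (Function.uncurry fun y s => deriv (fun z => k z s) y) :=
  (ContDiff.fderiv (f := fun (p : ℝ × ℝ) x => k x p.2) (g := Prod.fst)
    (hk.comp (by fun_prop : ContDiff ℝ (n + 1) fun q : (ℝ × ℝ) × ℝ => (q.2, q.1.2)))
    contDiff_fst le_rfl).clm_apply contDiff_const

/-- The total derivative along the diagonal is the sum of the partial derivatives. -/
theorem DifferentiableAt.hasDerivAt_diag {φ : ℝ × ℝ → ℝ} {y : ℝ}
    (hφ : DifferentiableAt ℝ φ (y, y)) :
    HasDerivAt (fun z => φ (z, z))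
      (deriv (fun z => φ (z, y)) y + deriv (fun z => φ (y, z)) y) y := by
  have hd := hφ.hasFDerivAt
  have hfst := hd.comp_hasDerivAt (f := fun z => (z, y)) y
    ((hasDerivAt_id' y).prodMk (hasDerivAt_const y y))
  have hsnd := hd.comp_hasDerivAt (f := fun z => (y, z)) y
    ((hasDerivAt_const y y).prodMk (hasDerivAt_id' y))
  have hdiag := hd.comp_hasDerivAt (f := fun z => (z, z)) y
    ((hasDerivAt_id' y).prodMk (hasDerivAt_id' y))
  rw [show deriv (fun z => φ (z, y)) y = _ from hfst.deriv,
    show deriv (fun z => φ (y, z)) y = _ from hsnd.deriv, ← map_add]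
  simpa using! hdiag

/-- The Leibniz rule for an integral whose upper endpoint is the parameter. -/
theorem hasDerivAt_intervalIntegral_diag {k : ℝ → ℝ → ℝ}
    (hk : ContDiff ℝ 1 (Function.uncurry k)) (c y : ℝ) :
    HasDerivAt (fun z => ∫ s in c..z, k z s)
      ((∫ s in c..y, deriv (fun z => k z s) y) + k y y) y := by
  have hΦ : ContDiff ℝ 1 fun p : ℝ × ℝ => ∫ s in c..p.2, k p.1 s :=
    ContDiff.intervalIntegral_param_endpoints (n := 1) (F := fun p : ℝ × ℝ => k p.1)
      (hk.comp (by fun_prop : ContDiff ℝ 1 fun q : (ℝ × ℝ) × ℝ => (q.1.1, q.2)))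
      contDiff_const contDiff_snd
  have hfst : HasDerivAt (fun z => ∫ s in c..y, k z s)
      (∫ s in c..y, deriv (fun z => k z s) y) y := by
    have h := (hasFDerivAt_intervalIntegral_of_contDiff hk c y y).hasDerivAt
    rw [ContinuousLinearMap.intervalIntegral_apply] at h
    · exact h
    · have hcont : Continuous fun s => fderiv ℝ (fun z => k z s) y :=
        (ContDiff.fderiv (n := 0) (f := fun (s : ℝ) x => k x s) (g := fun _ => y)
          (hk.comp (by fun_prop : ContDiff ℝ 1 fun q : ℝ × ℝ => (q.2, q.1)))
          contDiff_const (by norm_num)).continuous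
      exact hcont.intervalIntegrable _ _
  have hky : Continuous (k y) := hk.continuous.uncurry_left y
  have hsnd : HasDerivAt (fun z => ∫ s in c..z, k y s) (k y y) y :=
    integral_hasDerivAt_right (hky.intervalIntegrable _ _)
      hky.stronglyMeasurable.stronglyMeasurableAtFilter hky.continuousAt
  have hdiag := (hΦ.differentiable one_ne_zero (y, y)).hasDerivAt_diag
  rwa [hfst.deriv, hsnd.deriv] at hdiag

/-- The Leibniz rule for an integral whose lower endpoint is the parameter. -/
theorem hasDerivAt_intervalIntegral_diag_left {k : ℝ → ℝ → ℝ}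
    (hk : ContDiff ℝ 1 (Function.uncurry k)) (c y : ℝ) :
    HasDerivAt (fun z => ∫ s in z..c, k z s)
      ((∫ s in y..c, deriv (fun z => k z s) y) - k y y) y := by
  have h := (hasDerivAt_intervalIntegral_diag hk c y).neg
  simp only [neg_add, ← integral_symm] at h
  exact h.congr_of_eventuallyEq (.of_forall fun z => integral_symm _ _)

end PartialDerivatives

/-- The time derivative of a Volterra convolution against a function vanishing at `0`. -/
theorem hasDerivAt_integral_mul_comp_sub {u g : ℝ → ℝ} (hu : ContDiff ℝ 1 u)
    (hg : ContDiff ℝ 1 g) (hg0 : g 0 = 0) (x t : ℝ) :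
    HasDerivAt (fun τ => ∫ s in x..τ, u s * g (τ - s)) (∫ s in x..t, u s * deriv g (t - s)) t := by
  have h := hasDerivAt_intervalIntegral_diag (k := fun τ s => u s * g (τ - s))
    (by unfold Function.uncurry; fun_prop) x t
  simpa [deriv_comp_sub_const, hg0] using h

/-- The space derivative of `x ↦ ∫_x^t v(x,s) g(t - s) ds`. -/
theorem hasDerivAt_integral_left_mul_comp_sub {v : ℝ → ℝ → ℝ} {g : ℝ → ℝ}
    (hv : ContDiff ℝ 1 (Function.uncurry v)) (hg : ContDiff ℝ 1 g) (x t : ℝ) :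
    HasDerivAt (fun z => ∫ s in z..t, v z s * g (t - s))
      ((∫ s in x..t, deriv (fun z => v z s) x * g (t - s)) - v x x * g (t - x)) x := by
  have hk : ContDiff ℝ 1 (Function.uncurry fun z s => v z s * g (t - s)) :=
    hv.mul (hg.comp (by fun_prop : ContDiff ℝ 1 fun p : ℝ × ℝ => t - p.2))
  simpa using hasDerivAt_intervalIntegral_diag_left hk t x

/-- Integration by parts for a Volterra convolution against a function vanishing at `0`. -/
theorem integral_mul_deriv_comp_sub {u g : ℝ → ℝ} (hu : ContDiff ℝ 1 u) (hg : ContDiff ℝ 1 g)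
    (hg0 : g 0 = 0) (x t : ℝ) :
    ∫ s in x..t, u s * deriv g (t - s) =
      u x * g (t - x) + ∫ s in x..t, deriv u s * g (t - s) := by
  have hg' : Continuous (deriv g) := hg.continuous_deriv le_rfl
  have h := integral_mul_deriv_eq_deriv_mul (a := x) (b := t) (u := u) (u' := deriv u)
    (v := fun s => -g (t - s)) (v' := fun s => deriv g (t - s))
    (fun s _ => (hu.differentiable one_ne_zero s).hasDerivAt)
    (fun s _ => by
      simpa using!
        ((hg.differentiable one_ne_zero (t - s)).hasDerivAt.comp_const_sub t s).neg)
    ((hu.continuous_deriv le_rfl).intervalIntegrable _ _)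
    ((by fun_prop : Continuous fun s => deriv g (t - s)).intervalIntegrable _ _)
  simp only [h, sub_self, hg0, mul_neg, intervalIntegral.integral_neg]
  ring

theorem deriv_zero_of_eq_zero_of_nonpos {f : ℝ → ℝ} (hf : DifferentiableAt ℝ f 0)
    (hf0 : ∀ τ ≤ (0 : ℝ), f τ = 0) : deriv f 0 = 0 :=
  (uniqueDiffWithinAt_Iic 0).eq_deriv _ hf.hasDerivAt.hasDerivWithinAt
    ((hasDerivWithinAt_const 0 (Iic 0) (0 : ℝ)).congr hf0 (hf0 0 le_rfl))

/-- Differentiation under the integral sign for the Goursat-type term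
`G(x,t) = ∫_x^t w(x,s) f(t−s) ds` on the half-line `x > 0`:
`G_tt − G_xx = ∫_x^t (w_ss − w_xx)(x,s) f(t−s) ds + 2 (d/dx)[w(x,x)] f(t−x)`,
where `(d/dx)[w(x,x)] = w_x(x,x) + w_s(x,x)`. -/
theorem stmt2 (w : ℝ → ℝ → ℝ) (hw : ContDiff ℝ 2 (Function.uncurry w))
    (f : ℝ → ℝ) (hf : ContDiff ℝ (⊤ : ℕ∞) f) (hf0 : ∀ τ ≤ (0 : ℝ), f τ = 0)
    (G : ℝ → ℝ → ℝ)
    (hG : ∀ x t : ℝ, G x t = ∫ s in x..t, w x s * f (t - s)) :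
    ContDiffOn ℝ 2 (fun p : ℝ × ℝ => G p.1 p.2) {p : ℝ × ℝ | 0 < p.1 ∧ p.1 < p.2} ∧
    ∀ x t : ℝ, 0 < x → x < t →
      deriv (fun τ => deriv (fun σ => G x σ) τ) t
        - deriv (fun y => deriv (fun z => G z t) y) x
      = (∫ s in x..t,
          (deriv (deriv (w x)) s - deriv (fun y => deriv (fun z => w z s) y) x)
            * f (t - s))
        + 2 * (deriv (fun y => w y x) x + deriv (w x) x) * f (t - x) := by
  have hf2 : ContDiff ℝ 2 f := contDiff_infty.1 hf 2
  have hf1 : ContDiff ℝ 1 f := hf2.of_le one_le_two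
  have hf' : ContDiff ℝ 1 (deriv f) := hf2.deriv'
  have hf00 : f 0 = 0 := hf0 0 le_rfl
  have hf'0 : deriv f 0 = 0 :=
    deriv_zero_of_eq_zero_of_nonpos (hf1.differentiable one_ne_zero 0) hf0
  have hw1 : ContDiff ℝ 1 (Function.uncurry w) := hw.of_le one_le_two
  have hwx : ContDiff ℝ 1 (Function.uncurry fun y s => deriv (fun z => w z s) y) :=
    ContDiff.deriv_fst (n := 1) (by simpa [one_add_one_eq_two] using hw)
  have hwxx : Continuous (Function.uncurry fun y s =>
      deriv (fun y => deriv (fun z => w z s) y) y) :=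
    (ContDiff.deriv_fst (n := 0) (by simpa using hwx)).continuous
  refine ⟨?_, fun x t _ _ => ?_⟩
  · simp only [hG]
    refine (ContDiff.intervalIntegral_param_endpoints (n := 2)
      (F := fun (p : ℝ × ℝ) s => w p.1 s * f (p.2 - s)) ?_ contDiff_fst contDiff_snd).contDiffOn
    exact (hw.comp (by fun_prop : ContDiff ℝ 2 fun q : (ℝ × ℝ) × ℝ => (q.1.1, q.2))).mul
      (hf2.comp (by fun_prop : ContDiff ℝ 2 fun q : (ℝ × ℝ) × ℝ => q.1.2 - q.2))
  have hwx2 : ContDiff ℝ 2 (w x) :=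
    hw.comp (by fun_prop : ContDiff ℝ 2 fun s : ℝ => (x, s))
  have hwx1 : ContDiff ℝ 1 (w x) := hwx2.of_le one_le_two
  have hws : ContDiff ℝ 1 (deriv (w x)) := hwx2.deriv'
  have hGtt : deriv (fun τ => deriv (fun σ => G x σ) τ) t =
      w x x * deriv f (t - x) + (deriv (w x) x * f (t - x) +
        ∫ s in x..t, deriv (deriv (w x)) s * f (t - s)) := by
    simp only [hG, fun τ => (hasDerivAt_integral_mul_comp_sub hwx1 hf1 hf00 x τ).deriv]
    rw [(hasDerivAt_integral_mul_comp_sub hwx1 hf' hf'0 x t).deriv,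
      integral_mul_deriv_comp_sub hwx1 hf' hf'0, integral_mul_deriv_comp_sub hws hf1 hf00]
  have hdiag : HasDerivAt (fun y => w y y) (deriv (fun y => w y x) x + deriv (w x) x) x :=
    (hw1.differentiable one_ne_zero (x, x)).hasDerivAt_diag
  have hf_diff := (hf1.differentiable one_ne_zero (t - x)).hasDerivAt.comp_const_sub t x
  have hGxx : deriv (fun y => deriv (fun z => G z t) y) x =
      (∫ s in x..t, deriv (fun y => deriv (fun z => w z s) y) x * f (t - s))
        - deriv (fun y => w y x) x * f (t - x)
        - ((deriv (fun y => w y x) x + deriv (w x) x) * f (t - x)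
          + w x x * -deriv f (t - x)) := by
    simp only [hG, fun y => (hasDerivAt_integral_left_mul_comp_sub hw1 hf1 y t).deriv]
    exact ((hasDerivAt_integral_left_mul_comp_sub hwx hf1 x t).sub (hdiag.mul hf_diff)).deriv
  have hft : Continuous fun s => f (t - s) := by fun_prop
  have hss : Continuous fun s => deriv (deriv (w x)) s * f (t - s) :=
    (hws.continuous_deriv le_rfl).mul hft
  have hxx : Continuous fun s => deriv (fun y => deriv (fun z => w z s) y) x * f (t - s) :=
    (hwxx.uncurry_left x).mul hft
  rw [hGtt, hGxx]
  simp only [sub_mul]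
  rw [intervalIntegral.integral_sub (hss.intervalIntegrable _ _) (hxx.intervalIntegrable _ _)]
  ring
end

section
/- Let w : {(x,s) ∈ ℝ² : x ≤ 0, −x ≤ s} → ℝ be twice continuously differentiable, and let f : ℝ → ℝ be smooth with f(τ) = 0 for all τ ≤ 0. Define H(x,t) = ∫_{−x}^t w(x,s) f(t−s) ds for 0 < −x < t. Then H is twice continuously differentiable on {0 < −x < t} and ∂²H/∂t²(x,t) − ∂²H/∂x²(x,t) = ∫_{−x}^t (w_ss(x,s) − w_xx(x,s)) f(t−s) ds − 2 (d/dx)[w(x,−x)] f(t+x), where (d/dx)[w(x,−x)] = w_x(x,−x) − w_s(x,−x) is the total derivative of w along the anti-diagonal. -/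
open Set Filter Topology intervalIntegral

section ParametricIntegral

universe u

/-- The derivative of an integral over a fixed interval of a `C¹` function of the parameter and
the integration variable. -/
theorem hasFDerivAt_intervalIntegral_of_contDiff_one {E F : Type*}
    [NormedAddCommGroup E] [NormedSpace ℝ E] [ProperSpace E]
    [NormedAddCommGroup F] [NormedSpace ℝ F] {k : E → ℝ → F}
    (hk : ContDiff ℝ 1 (Function.uncurry k)) (a b : ℝ) (p : E) :
    HasFDerivAt (fun q => ∫ s in a..b, k q s)
      (∫ s in a..b, (fderiv ℝ (Function.uncurry k) (p, s)).comp
        (ContinuousLinearMap.inl ℝ E ℝ)) p := by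
  have hcont : Continuous (fun q : E × ℝ => (fderiv ℝ (Function.uncurry k) q).comp
      (ContinuousLinearMap.inl ℝ E ℝ)) :=
    (hk.continuous_fderiv one_ne_zero).clm_comp continuous_const
  obtain ⟨C, hC⟩ := ((isCompact_closedBall p 1).prod (isCompact_uIcc (a := a) (b := b))
    ).exists_bound_of_continuousOn hcont.continuousOn
  have hks : ∀ q, Continuous (k q) := fun q => hk.continuous.comp (Continuous.prodMk_right q)
  refine intervalIntegral.hasFDerivAt_integral_of_dominated_of_fderiv_le
    (F' := fun q s => (fderiv ℝ (Function.uncurry k) (q, s)).comp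
      (ContinuousLinearMap.inl ℝ E ℝ)) (bound := fun _ => C)
    (Metric.closedBall_mem_nhds p one_pos)
    (Eventually.of_forall fun q => (hks q).aestronglyMeasurable)
    ((hks p).intervalIntegrable _ _)
    (hcont.comp (Continuous.prodMk_right p)).aestronglyMeasurable
    (Eventually.of_forall fun s hs q hq => hC (q, s) ⟨hq, uIoc_subset_uIcc hs⟩)
    intervalIntegrable_const
    (Eventually.of_forall fun s _ q _ => ?_)
  exact ((hk.differentiable one_ne_zero (q, s)).hasFDerivAt).comp (f := fun q => (q, s)) q
    (hasFDerivAt_prodMk_left q s)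

theorem contDiff_intervalIntegral {E F : Type u}
    [NormedAddCommGroup E] [NormedSpace ℝ E] [ProperSpace E]
    [NormedAddCommGroup F] [NormedSpace ℝ F] {k : E → ℝ → F} {n : ℕ}
    (hk : ContDiff ℝ n (Function.uncurry k)) (a b : ℝ) :
    ContDiff ℝ n (fun q => ∫ s in a..b, k q s) := by
  induction n generalizing F with
  | zero =>
    exact contDiff_zero.2
      (continuous_parametric_intervalIntegral_of_continuous' hk.continuous a b)
  | succ n ih =>
    push_cast at hk ⊢
    refine contDiff_succ_iff_hasFDerivAt.2 ⟨_, ?_, fun p =>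
      hasFDerivAt_intervalIntegral_of_contDiff_one (hk.of_le le_add_self) a b p⟩
    exact ih (k := fun p s => (fderiv ℝ (Function.uncurry k) (p, s)).comp
      (ContinuousLinearMap.inl ℝ E ℝ)) ((hk.fderiv_right le_rfl).clm_comp contDiff_const)

/-- An integral with `Cⁿ` endpoints of a `Cⁿ` integrand is a `Cⁿ` function of the parameter. -/
theorem ContDiff.intervalIntegral_endpoints {E F : Type u}
    [NormedAddCommGroup E] [NormedSpace ℝ E] [ProperSpace E]
    [NormedAddCommGroup F] [NormedSpace ℝ F] {k : E → ℝ → F} {n : ℕ}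
    (hk : ContDiff ℝ n (Function.uncurry k)) {a b : E → ℝ}
    (ha : ContDiff ℝ n a) (hb : ContDiff ℝ n b) :
    ContDiff ℝ n (fun q => ∫ s in a q..b q, k q s) := by
  have heq : (fun q => ∫ s in a q..b q, k q s) =
      fun q => (b q - a q) • ∫ r in (0 : ℝ)..1, k q ((b q - a q) * r + a q) := by
    funext q
    rw [intervalIntegral.smul_integral_comp_mul_add (fun s => k q s)]
    simp
  rw [heq]
  refine (hb.sub ha).smul (contDiff_intervalIntegral
    (k := fun q r => k q ((b q - a q) * r + a q)) ?_ 0 1)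
  have ha' : ContDiff ℝ n (fun z : E × ℝ => a z.1) := ha.comp contDiff_fst
  have hb' : ContDiff ℝ n (fun z : E × ℝ => b z.1) := hb.comp contDiff_fst
  exact hk.comp (contDiff_fst.prodMk (((hb'.sub ha').mul contDiff_snd).add ha'))

/-- The Leibniz integral rule with a moving upper endpoint. -/
theorem hasDerivAt_intervalIntegral_upper {F : Type}
    [NormedAddCommGroup F] [NormedSpace ℝ F] [CompleteSpace F] {k k' : ℝ → ℝ → F}
    (hk : ContDiff ℝ 1 (Function.uncurry k))
    (hk' : ∀ y s, HasDerivAt (fun z => k z s) (k' y s) y) (c : ℝ) {v : ℝ → ℝ} {v' y : ℝ}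
    (hv : HasDerivAt v v' y) :
    HasDerivAt (fun z => ∫ s in c..v z, k z s)
      (v' • k y (v y) + ∫ s in c..v y, k' y s) y := by
  have hΨ : ContDiff ℝ 1 (fun q : ℝ × ℝ => ∫ s in c..q.2, k q.1 s) :=
    ContDiff.intervalIntegral_endpoints (n := 1) (k := fun (q : ℝ × ℝ) s => k q.1 s)
      (hk.comp ((contDiff_fst.comp contDiff_fst).prodMk contDiff_snd)) contDiff_const contDiff_snd
  obtain ⟨L, hL⟩ : ∃ L, HasFDerivAt (fun q : ℝ × ℝ => ∫ s in c..q.2, k q.1 s) L (y, v y) :=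
    ⟨_, (hΨ.differentiable one_ne_zero _).hasFDerivAt⟩
  have hky : Continuous (k y) := hk.continuous.comp (Continuous.prodMk_right y)
  have hsnd : L (0, 1) = k y (v y) :=
    (hL.comp_hasDerivAt (v y) ((hasDerivAt_const (v y) y).prodMk (hasDerivAt_id (v y)))).unique
      (integral_hasDerivAt_right (hky.intervalIntegrable _ _)
        (hky.stronglyMeasurableAtFilter _ _) hky.continuousAt)
  have hfst : L (1, 0) = ∫ s in c..v y, k' y s := by
    have h1 : HasDerivAt (fun z => ∫ s in c..v y, k z s) (L (1, 0)) y :=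
      hL.comp_hasDerivAt (f := fun z => (z, v y)) y
        ((hasDerivAt_id y).prodMk (hasDerivAt_const y (v y)))
    have h2 := (hasFDerivAt_intervalIntegral_of_contDiff_one hk c (v y) y).hasDerivAt
    rw [h1.unique h2, ContinuousLinearMap.intervalIntegral_apply]
    · refine integral_congr fun s _ => ?_
      have h3 : HasDerivAt (fun z => k z s) (fderiv ℝ (Function.uncurry k) (y, s) (1, 0)) y :=
        (hk.differentiable one_ne_zero (y, s)).hasFDerivAt.comp_hasDerivAt
          (f := fun z => (z, s)) y ((hasDerivAt_id y).prodMk (hasDerivAt_const y s))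
      simpa using h3.unique (hk' y s)
    · exact (((hk.continuous_fderiv one_ne_zero).clm_comp continuous_const).comp
        (Continuous.prodMk_right y)).intervalIntegrable _ _
  have h := hL.comp_hasDerivAt y ((hasDerivAt_id y).prodMk hv)
  have hsplit : ((1 : ℝ), v') = (1, 0) + v' • ((0 : ℝ), (1 : ℝ)) := by simp
  rw [hsplit, map_add, map_smul, hfst, hsnd, add_comm] at h
  exact h

/-- The Leibniz integral rule with a moving lower endpoint. -/
theorem hasDerivAt_intervalIntegral_lower {F : Type}
    [NormedAddCommGroup F] [NormedSpace ℝ F] [CompleteSpace F] {k k' : ℝ → ℝ → F}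
    (hk : ContDiff ℝ 1 (Function.uncurry k))
    (hk' : ∀ y s, HasDerivAt (fun z => k z s) (k' y s) y) (c : ℝ) {v : ℝ → ℝ} {v' y : ℝ}
    (hv : HasDerivAt v v' y) :
    HasDerivAt (fun z => ∫ s in v z..c, k z s)
      (-(v' • k y (v y)) + ∫ s in v y..c, k' y s) y := by
  have h := (hasDerivAt_intervalIntegral_upper hk hk' c hv).neg
  have heq : -(v' • k y (v y) + ∫ s in c..v y, k' y s) =
      -(v' • k y (v y)) + ∫ s in v y..c, k' y s := by
    rw [integral_symm c (v y), neg_add]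
  rw [heq] at h
  refine h.congr_of_eventuallyEq (Eventually.of_forall fun z => ?_)
  simp [integral_symm c (v z)]

end ParametricIntegral

section PartialDerivatives

variable {w : ℝ → ℝ → ℝ}

theorem hasDerivAt_uncurry_comp (hw : Differentiable ℝ (Function.uncurry w))
    {a b : ℝ → ℝ} {a' b' y : ℝ} (ha : HasDerivAt a a' y) (hb : HasDerivAt b b' y) :
    HasDerivAt (fun z => w (a z) (b z))
      (a' * deriv (fun z => w z (b y)) (a y) + b' * deriv (w (a y)) (b y)) y := by
  have hL := (hw (a y, b y)).hasFDerivAt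
  have h1 : HasDerivAt (fun z => w z (b y))
      (fderiv ℝ (Function.uncurry w) (a y, b y) (1, 0)) (a y) :=
    hL.comp_hasDerivAt (f := fun z => (z, b y)) (a y)
      ((hasDerivAt_id _).prodMk (hasDerivAt_const _ _))
  have h2 : HasDerivAt (w (a y)) (fderiv ℝ (Function.uncurry w) (a y, b y) (0, 1)) (b y) :=
    hL.comp_hasDerivAt (f := fun z => (a y, z)) (b y)
      ((hasDerivAt_const _ _).prodMk (hasDerivAt_id _))
  have h := hL.comp_hasDerivAt y (ha.prodMk hb)
  have hsplit : (a', b') = a' • ((1 : ℝ), (0 : ℝ)) + b' • ((0 : ℝ), (1 : ℝ)) := by simp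
  rw [hsplit, map_add, map_smul, map_smul, ← h1.deriv, ← h2.deriv] at h
  exact h

theorem contDiff_deriv_fst {n : WithTop ℕ∞} (hw : ContDiff ℝ (n + 1) (Function.uncurry w)) :
    ContDiff ℝ n (Function.uncurry fun y s => deriv (fun z => w z s) y) := by
  have heq : (Function.uncurry fun y s => deriv (fun z => w z s) y) =
      fun q => fderiv ℝ (Function.uncurry w) q (1, 0) := by
    funext ⟨y, s⟩
    exact ((hw.differentiable (by simp) (y, s)).hasFDerivAt.comp_hasDerivAt
      (f := fun z => (z, s)) y ((hasDerivAt_id y).prodMk (hasDerivAt_const y s))).deriv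
  rw [heq]
  exact (hw.fderiv_right le_rfl).clm_apply contDiff_const

end PartialDerivatives

theorem deriv_eq_zero_of_eqOn_Iic {f : ℝ → ℝ} {a : ℝ} (hf : DifferentiableAt ℝ f a)
    (h : ∀ τ ≤ a, f τ = 0) : deriv f a = 0 :=
  (uniqueDiffWithinAt_Iic a).eq_deriv _ hf.hasDerivAt.hasDerivWithinAt
    ((hasDerivWithinAt_const a (Iic a) (0 : ℝ)).congr h (h a le_rfl))

section Goursat

variable {w : ℝ → ℝ → ℝ} {f : ℝ → ℝ}

/-- The time derivative of the Goursat term falls on `f` when `f 0 = 0`. -/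
theorem hasDerivAt_goursat_time (hw : ContDiff ℝ 1 (Function.uncurry w)) (hf : ContDiff ℝ 1 f)
    (hf0 : f 0 = 0) (x t : ℝ) :
    HasDerivAt (fun τ => ∫ s in (-x)..τ, w x s * f (τ - s))
      (∫ s in (-x)..t, w x s * deriv f (t - s)) t := by
  have hk : ContDiff ℝ 1 (Function.uncurry fun τ s => w x s * f (τ - s)) :=
    (hw.comp (contDiff_const.prodMk contDiff_snd)).mul
      (hf.comp (contDiff_fst.sub contDiff_snd))
  have h := hasDerivAt_intervalIntegral_upper (k' := fun τ s => w x s * deriv f (τ - s)) hk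
    (fun τ s => (((hf.differentiable one_ne_zero (τ - s)).hasDerivAt).comp_sub_const τ s).const_mul
      (w x s)) (-x) (hasDerivAt_id t)
  simpa [hf0] using h

theorem hasDerivAt_goursat_space (hw : ContDiff ℝ 1 (Function.uncurry w)) (hf : ContDiff ℝ 1 f)
    (x t : ℝ) :
    HasDerivAt (fun y => ∫ s in (-y)..t, w y s * f (t - s))
      (w x (-x) * f (t + x) + ∫ s in (-x)..t, deriv (fun y => w y s) x * f (t - s)) x := by
  have hk : ContDiff ℝ 1 (Function.uncurry fun y s => w y s * f (t - s)) :=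
    hw.mul (hf.comp (contDiff_const.sub contDiff_snd))
  have hd : ∀ y s, HasDerivAt (fun z => w z s) (deriv (fun z => w z s) y) y := fun y s => by
    simpa using hasDerivAt_uncurry_comp (hw.differentiable one_ne_zero)
      (hasDerivAt_id y) (hasDerivAt_const y s)
  have h := hasDerivAt_intervalIntegral_lower
    (k' := fun y s => deriv (fun z => w z s) y * f (t - s)) hk
    (fun y s => (hd y s).mul_const _) t (hasDerivAt_neg x)
  simpa using h

theorem integral_mul_deriv_deriv_sub {g f : ℝ → ℝ} (hg : ContDiff ℝ 2 g) (hf : ContDiff ℝ 2 f)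
    (hf0 : f 0 = 0) (hf1 : deriv f 0 = 0) (a t : ℝ) :
    ∫ s in a..t, g s * deriv (deriv f) (t - s) =
      (∫ s in a..t, deriv (deriv g) s * f (t - s)) + g a * deriv f (t - a) +
        deriv g a * f (t - a) := by
  have hg' : ContDiff ℝ 1 (deriv g) := hg.deriv' (n := 1)
  have hf' : ContDiff ℝ 1 (deriv f) := hf.deriv' (n := 1)
  have hfc : Continuous fun s => f (t - s) := hf.continuous.comp (continuous_const.sub continuous_id)
  have hfc'' : Continuous fun s => deriv (deriv f) (t - s) :=
    (hf'.continuous_deriv le_rfl).comp (continuous_const.sub continuous_id)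
  have hi1 : IntervalIntegrable (fun s => g s * deriv (deriv f) (t - s)) MeasureTheory.volume a t :=
    (hg.continuous.mul hfc'').intervalIntegrable _ _
  have hi2 : IntervalIntegrable (fun s => deriv (deriv g) s * f (t - s)) MeasureTheory.volume a t :=
    ((hg'.continuous_deriv le_rfl).mul hfc).intervalIntegrable _ _
  have hF : ∀ s, HasDerivAt (fun s => -(g s * deriv f (t - s)) - deriv g s * f (t - s))
      (g s * deriv (deriv f) (t - s) - deriv (deriv g) s * f (t - s)) s := fun s => by
    have h1 := (hf.differentiable two_ne_zero (t - s)).hasDerivAt.comp_const_sub t s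
    have h2 := (hf'.differentiable one_ne_zero (t - s)).hasDerivAt.comp_const_sub t s
    have h3 := (hg.differentiable two_ne_zero s).hasDerivAt
    have h4 := (hg'.differentiable one_ne_zero s).hasDerivAt
    refine ((h3.mul h2).neg.sub (h4.mul h1)).congr_deriv ?_
    ring
  have h := integral_eq_sub_of_hasDerivAt (fun s _ => hF s) (hi1.sub hi2)
  rw [integral_sub hi1 hi2] at h
  simp only [sub_self, hf0, hf1, mul_zero, neg_zero] at h
  linarith

end Goursat

/-- Differentiation under the integral sign for the Goursat-type term
`H(x,t) = ∫_{−x}^t w(x,s) f(t−s) ds` on the half-line `x < 0`: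
`H_tt − H_xx = ∫_{−x}^t (w_ss − w_xx)(x,s) f(t−s) ds − 2 (d/dx)[w(x,−x)] f(t+x)`,
where `(d/dx)[w(x,−x)] = w_x(x,−x) − w_s(x,−x)`. -/
theorem stmt3 (w : ℝ → ℝ → ℝ) (hw : ContDiff ℝ 2 (Function.uncurry w))
    (f : ℝ → ℝ) (hf : ContDiff ℝ (⊤ : ℕ∞) f) (hf0 : ∀ τ ≤ (0 : ℝ), f τ = 0)
    (H : ℝ → ℝ → ℝ)
    (hH : ∀ x t : ℝ, H x t = ∫ s in (-x)..t, w x s * f (t - s)) :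
    ContDiffOn ℝ 2 (fun p : ℝ × ℝ => H p.1 p.2) {p : ℝ × ℝ | 0 < -p.1 ∧ -p.1 < p.2} ∧
    ∀ x t : ℝ, 0 < -x → -x < t →
      deriv (fun τ => deriv (fun σ => H x σ) τ) t
        - deriv (fun y => deriv (fun z => H z t) y) x
      = (∫ s in (-x)..t,
          (deriv (deriv (w x)) s - deriv (fun y => deriv (fun z => w z s) y) x)
            * f (t - s))
        - 2 * (deriv (fun y => w y (-x)) x - deriv (w x) (-x)) * f (t + x) := by
  obtain rfl : H = fun x t => ∫ s in (-x)..t, w x s * f (t - s) := funext₂ hH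
  have hf2 : ContDiff ℝ 2 f := hf.of_le (WithTop.coe_le_coe.2 le_top)
  have hf1 : ContDiff ℝ 1 f := hf2.of_le one_le_two
  have hf' : ContDiff ℝ 1 (deriv f) := hf2.deriv' (n := 1)
  have hw1 : ContDiff ℝ 1 (Function.uncurry w) := hw.of_le one_le_two
  have hf00 : f 0 = 0 := hf0 0 le_rfl
  have hf'0 : deriv f 0 = 0 :=
    deriv_eq_zero_of_eqOn_Iic (hf1.differentiable one_ne_zero 0) hf0
  refine ⟨ContDiff.contDiffOn ?_, fun x t _ _ => ?_⟩
  · refine ContDiff.intervalIntegral_endpoints (n := 2)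
      (k := fun (p : ℝ × ℝ) s => w p.1 s * f (p.2 - s)) ?_ contDiff_fst.neg contDiff_snd
    exact (hw.comp ((contDiff_fst.comp contDiff_fst).prodMk contDiff_snd)).mul
      (hf2.comp ((contDiff_snd.comp contDiff_fst).sub contDiff_snd))
  have hwx : ContDiff ℝ 1 (Function.uncurry fun y s => deriv (fun z => w z s) y) :=
    contDiff_deriv_fst (by rwa [one_add_one_eq_two])
  have hwxs : ContDiff ℝ 2 (w x) := hw.comp (contDiff_const.prodMk contDiff_id)
  have htt : deriv (fun τ => deriv (fun σ => ∫ s in (-x)..σ, w x s * f (σ - s)) τ) t =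
      ∫ s in (-x)..t, w x s * deriv (deriv f) (t - s) := by
    simp only [fun τ => (hasDerivAt_goursat_time hw1 hf1 hf00 x τ).deriv]
    exact (hasDerivAt_goursat_time hw1 hf' hf'0 x t).deriv
  have hdiag : HasDerivAt (fun y => w y (-y))
      (deriv (fun y => w y (-x)) x - deriv (w x) (-x)) x := by
    simpa [sub_eq_add_neg] using hasDerivAt_uncurry_comp (hw1.differentiable one_ne_zero)
      (hasDerivAt_id x) (hasDerivAt_neg x)
  have hxx : deriv (fun y => deriv (fun z => ∫ s in (-z)..t, w z s * f (t - s)) y) x =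
      (deriv (fun y => w y (-x)) x - deriv (w x) (-x)) * f (t + x) +
        w x (-x) * deriv f (t + x) + (deriv (fun y => w y (-x)) x * f (t + x) +
        ∫ s in (-x)..t, deriv (fun y => deriv (fun z => w z s) y) x * f (t - s)) := by
    simp only [fun y => (hasDerivAt_goursat_space hw1 hf1 y t).deriv]
    exact ((hdiag.mul ((hf1.differentiable one_ne_zero (t + x)).hasDerivAt.comp_const_add t x)).add
      (hasDerivAt_goursat_space hwx hf1 x t)).deriv
  have hfc : Continuous fun s => f (t - s) :=
    hf.continuous.comp (continuous_const.sub continuous_id)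
  have hss : Continuous (deriv (deriv (w x))) :=
    (hwxs.deriv' (n := 1)).continuous_deriv le_rfl
  have hwxx : Continuous fun s => deriv (fun y => deriv (fun z => w z s) y) x :=
    (contDiff_deriv_fst (w := fun y s => deriv (fun z => w z s) y) (n := 0)
      (by rwa [zero_add])).continuous.comp (Continuous.prodMk_right x)
  simp only [sub_mul]
  rw [htt, hxx, integral_sub (Continuous.intervalIntegrable (by fun_prop) _ _)
    (Continuous.intervalIntegrable (by fun_prop) _ _), integral_mul_deriv_deriv_sub hwxs hf2 hf00 hf'0]
  simp only [sub_neg_eq_add]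
  ring
end

section
/- Let q : [0,∞) → ℝ be continuous, let f₁, f₂ : ℝ → ℝ be smooth functions vanishing on (-∞,0], and let w₁, w₂ : {(x,s) : 0 ≤ x ≤ s} → ℝ be twice continuously differentiable kernels satisfying the Goursat problems: (wᵢ)_ss(x,s) − (wᵢ)_xx(x,s) + q(x) wᵢ(x,s) = 0 for 0 < x < s (i = 1,2), together with the characteristic conditions (d/dx)[w₁(x,x)] = −q(x)/4 and (d/dx)[w₂(x,x)] = q(x)/4 for x > 0. Define u(x,t) = (1/2)f₁(t−x) − (1/2)f₂(t−x) + ∫_x^t (w₁(x,s) f₁(t−s) + w₂(x,s) f₂(t−s)) ds for x > 0, t > 0. Then u_tt(x,t) − u_xx(x,t) + q(x) u(x,t) = 0 for all 0 < x < t, and u(x,t) = 0 whenever 0 < t < x. -/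
open Set Filter Topology intervalIntegral

/-- Leibniz rule for an integral whose parameter is also the upper endpoint. -/
lemma hasDerivAt_integral_param_endpoint {H H' : ℝ → ℝ → ℝ}
    (hH : Continuous (Function.uncurry H)) (hH' : Continuous (Function.uncurry H'))
    (hd : ∀ p s, HasDerivAt (fun z => H z s) (H' p s) p) (a p : ℝ) :
    HasDerivAt (fun z => ∫ s in a..z, H z s) ((∫ s in a..p, H' p s) + H p p) p := by
  have hcH : ∀ p, Continuous (H p) := fun p => hH.comp (by fun_prop : Continuous fun s => (p, s))
  have hcH' : ∀ p, Continuous (H' p) :=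
    fun p => hH'.comp (by fun_prop : Continuous fun s => (p, s))
  have hparam : ∀ p r, HasDerivAt (fun z => ∫ s in a..r, H z s) (∫ s in a..r, H' p s) p := by
    intro p r
    obtain ⟨C, hC⟩ := ((isCompact_closedBall p 1).prod (isCompact_uIcc (a := a) (b := r))
      ).exists_bound_of_continuousOn hH'.continuousOn
    refine (intervalIntegral.hasDerivAt_integral_of_dominated_loc_of_deriv_le (bound := fun _ => C)
      (F' := H') (Metric.closedBall_mem_nhds p one_pos)
      (Eventually.of_forall fun z => (hcH z).aestronglyMeasurable)
      ((hcH p).intervalIntegrable _ _) (hcH' p).aestronglyMeasurable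
      (Eventually.of_forall fun s hs z hz => ?_) (by simp)
      (Eventually.of_forall fun s _ z _ => hd z s)).2
    exact hC (z, s) ⟨hz, uIoc_subset_uIcc hs⟩
  have hend : ∀ p r, HasDerivAt (fun z => ∫ s in a..z, H p s) (H p r) r := fun p r =>
    (hcH p).integral_hasStrictDerivAt a r |>.hasDerivAt
  have hF : Continuous fun v : ℝ × ℝ => ∫ s in a..v.2, H' v.1 s :=
    continuous_parametric_primitive_of_continuous hH'
  have key := hasStrictFDerivAt_uncurry_coprod (𝕜 := ℝ) (u := (p, p))
    (f := fun p r => ∫ s in a..r, H p s)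
    (f₁ := fun p r => ContinuousLinearMap.toSpanSingleton ℝ (∫ s in a..r, H' p s))
    (f₂ := fun p r => ContinuousLinearMap.toSpanSingleton ℝ (H p r))
    (Eventually.of_forall fun v => (hparam v.1 v.2).hasFDerivAt)
    (Eventually.of_forall fun v => (hend v.1 v.2).hasFDerivAt)
    ((ContinuousLinearMap.toSpanSingletonCLE (𝕜 := ℝ)).continuous.comp hF).continuousAt
    ((ContinuousLinearMap.toSpanSingletonCLE (𝕜 := ℝ)).continuous.comp hH).continuousAt
  have := key.hasFDerivAt.comp_hasDerivAt (f := fun z => (z, z)) p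
    ((hasDerivAt_id p).prodMk (hasDerivAt_id p))
  simpa [Function.HasUncurry.uncurry, Function.comp_def] using this

/-- The partial derivatives of a `C^(n+1)` function of two real variables exist, are `C^n`, and
give the derivative along the diagonal. -/
lemma exists_partial_derivs {n : WithTop ℕ∞} {w : ℝ → ℝ → ℝ}
    (hw : ContDiff ℝ (n + 1) (Function.uncurry w)) :
    ∃ wx ws : ℝ → ℝ → ℝ, ContDiff ℝ n (Function.uncurry wx) ∧
      ContDiff ℝ n (Function.uncurry ws) ∧
      (∀ x s, HasDerivAt (fun z => w z s) (wx x s) x) ∧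
      (∀ x s, HasDerivAt (w x) (ws x s) s) ∧
      ∀ x, HasDerivAt (fun y => w y y) (wx x x + ws x x) x := by
  have hd : ContDiff ℝ n (fderiv ℝ (Function.uncurry w)) := hw.fderiv_right le_rfl
  have hF : ∀ v, HasFDerivAt (Function.uncurry w) (fderiv ℝ (Function.uncurry w) v) v :=
    fun v => (hw.differentiable (by simp) v).hasFDerivAt
  refine ⟨fun x s => fderiv ℝ (Function.uncurry w) (x, s) (1, 0),
    fun x s => fderiv ℝ (Function.uncurry w) (x, s) (0, 1),
    hd.clm_apply contDiff_const, hd.clm_apply contDiff_const, fun x s => ?_, fun x s => ?_,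
    fun x => ?_⟩
  · exact (hF (x, s)).comp_hasDerivAt x ((hasDerivAt_id x).prodMk (hasDerivAt_const x s))
  · exact (hF (x, s)).comp_hasDerivAt s ((hasDerivAt_const s x).prodMk (hasDerivAt_id s))
  · have := (hF (x, x)).comp_hasDerivAt (f := fun y => (y, y)) x
      ((hasDerivAt_id x).prodMk (hasDerivAt_id x))
    rw [← map_add]
    simpa [Function.comp_def] using this

lemma hasDerivAt_convolution_time {w : ℝ → ℝ → ℝ} (hw : Continuous (Function.uncurry w))
    {f f' : ℝ → ℝ} (hf' : Continuous f') (hf : ∀ r, HasDerivAt f (f' r) r) (hf0 : f 0 = 0)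
    (x t : ℝ) :
    HasDerivAt (fun τ => ∫ s in x..τ, w x s * f (τ - s)) (∫ s in x..t, w x s * f' (t - s)) t := by
  have hfc : Continuous f := continuous_iff_continuousAt.2 fun r => (hf r).continuousAt
  have hwx : Continuous fun v : ℝ × ℝ => w x v.2 :=
    hw.comp (by fun_prop : Continuous fun v : ℝ × ℝ => (x, v.2))
  have := hasDerivAt_integral_param_endpoint (H := fun τ s => w x s * f (τ - s))
    (H' := fun τ s => w x s * f' (τ - s)) (hwx.mul (by fun_prop)) (hwx.mul (by fun_prop))
    (fun τ s => ((hf (τ - s)).comp_sub_const τ s).const_mul _) x t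
  simpa [hf0] using this

lemma hasDerivAt_convolution_space {w wx : ℝ → ℝ → ℝ} (hw : Continuous (Function.uncurry w))
    (hwx : Continuous (Function.uncurry wx))
    (hd : ∀ x s, HasDerivAt (fun z => w z s) (wx x s) x)
    {f : ℝ → ℝ} (hf : Continuous f) (x t : ℝ) :
    HasDerivAt (fun y => ∫ s in y..t, w y s * f (t - s))
      ((∫ s in x..t, wx x s * f (t - s)) - w x x * f (t - x)) x := by
  have hft : Continuous fun v : ℝ × ℝ => f (t - v.2) := by fun_prop
  have := (hasDerivAt_integral_param_endpoint (H := fun y s => w y s * f (t - s))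
    (H' := fun y s => wx y s * f (t - s)) (hw.mul hft) (hwx.mul hft)
    (fun y s => (hd y s).mul_const _) t x).neg
  refine (this.congr_deriv ?_).congr_of_eventuallyEq (Eventually.of_forall fun y => ?_)
  · rw [neg_add, ← integral_symm]; ring
  · exact integral_symm _ _

/-- The derivative of a function vanishing on `(-∞, 0]` vanishes there too. -/
lemma deriv_eq_zero_of_eq_zero_of_nonpos {f : ℝ → ℝ} (hf : Differentiable ℝ f)
    (hf0 : ∀ t ≤ (0 : ℝ), f t = 0) : ∀ t ≤ (0 : ℝ), deriv f t = 0 := by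
  intro t ht
  have h : HasDerivWithinAt f 0 (Iic 0) t :=
    (hasDerivWithinAt_const t (Iic 0) (0 : ℝ)).congr hf0 (hf0 t ht)
  exact (uniqueDiffOn_Iic (0 : ℝ) t ht).eq_deriv _ (hf t).hasDerivAt.hasDerivWithinAt h

/-- A single travelling wave together with its convolution tail is twice differentiable in each
variable, and solves the wave equation when the kernel solves the Goursat problem. -/
lemma exists_wave_derivs {q : ℝ → ℝ} {c : ℝ} {f : ℝ → ℝ} (hf : ContDiff ℝ 2 f)
    (hf0 : ∀ t ≤ (0 : ℝ), f t = 0) {w : ℝ → ℝ → ℝ} (hw : ContDiff ℝ 2 (Function.uncurry w))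
    (hgoursat : ∀ x s : ℝ, 0 < x → x < s →
      deriv (deriv (w x)) s - deriv (fun y => deriv (fun z => w z s) y) x + q x * w x s = 0)
    (hchar : ∀ x : ℝ, 0 < x → 2 * deriv (fun y => w y y) x = -(c * q x))
    {U : ℝ → ℝ → ℝ}
    (hU : ∀ x t, U x t = c * f (t - x) + ∫ s in x..t, w x s * f (t - s)) :
    ∃ Ut Utt Ux Uxx : ℝ → ℝ → ℝ,
      (∀ x t, HasDerivAt (U x) (Ut x t) t) ∧ (∀ x t, HasDerivAt (Ut x) (Utt x t) t) ∧
      (∀ x t, HasDerivAt (fun y => U y t) (Ux x t) x) ∧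
      (∀ x t, HasDerivAt (fun y => Ux y t) (Uxx x t) x) ∧
      ∀ x t, 0 < x → x < t → Utt x t - Uxx x t + q x * U x t = 0 := by
  obtain ⟨wx, ws, hwx, hws, hdx, hds, hdiag⟩ := exists_partial_derivs (n := 1) (by
    simpa only [one_add_one_eq_two] using hw)
  obtain ⟨wxx, -, hwxx, -, hdxx, -, -⟩ := exists_partial_derivs (n := 0) (by
    simpa only [zero_add] using hwx)
  obtain ⟨-, wss, -, hwss, -, hdss, -⟩ := exists_partial_derivs (n := 0) (by
    simpa only [zero_add] using hws)
  have hf1 : ContDiff ℝ 1 (deriv f) := by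
    have : ContDiff ℝ (1 + 1) f := by simpa only [one_add_one_eq_two] using hf
    exact (contDiff_succ_iff_deriv.1 this).2.2
  have hf2 : Continuous (deriv (deriv f)) := hf1.continuous_deriv le_rfl
  have hdf : ∀ r, HasDerivAt f (deriv f r) r :=
    fun r => (hf.differentiable (by simp) r).hasDerivAt
  have hddf : ∀ r, HasDerivAt (deriv f) (deriv (deriv f) r) r :=
    fun r => (hf1.differentiable (by simp) r).hasDerivAt
  have hdf0 : deriv f 0 = 0 :=
    deriv_eq_zero_of_eq_zero_of_nonpos (hf.differentiable (by simp)) hf0 0 le_rfl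
  have hneg : ∀ {g g' : ℝ → ℝ} (_ : ∀ r, HasDerivAt g (g' r) r) (x t : ℝ),
      HasDerivAt (fun y => g (t - y)) (-g' (t - x)) x := fun h x t =>
    (h (t - x)).comp_const_sub t x
  obtain rfl : U = fun x t => c * f (t - x) + ∫ s in x..t, w x s * f (t - s) := by
    funext x t; exact hU x t
  refine ⟨fun x t => c * deriv f (t - x) + ∫ s in x..t, w x s * deriv f (t - s),
    fun x t => c * deriv (deriv f) (t - x) + ∫ s in x..t, w x s * deriv (deriv f) (t - s),
    fun x t => c * -deriv f (t - x) + ((∫ s in x..t, wx x s * f (t - s)) - w x x * f (t - x)),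
    fun x t => c * - -deriv (deriv f) (t - x) + (((∫ s in x..t, wxx x s * f (t - s))
      - wx x x * f (t - x)) - ((wx x x + ws x x) * f (t - x) + w x x * -deriv f (t - x))),
    fun x t => ?_, fun x t => ?_, fun x t => ?_, fun x t => ?_, fun x t hx hxt => ?_⟩
  · exact (((hdf (t - x)).comp_sub_const t x).const_mul c).add
      (hasDerivAt_convolution_time hw.continuous hf1.continuous hdf (hf0 0 le_rfl) x t)
  · exact (((hddf (t - x)).comp_sub_const t x).const_mul c).add
      (hasDerivAt_convolution_time hw.continuous hf2 hddf hdf0 x t)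
  · exact ((hneg hdf x t).const_mul c).add
      (hasDerivAt_convolution_space hw.continuous hwx.continuous hdx hf.continuous x t)
  · exact ((hneg hddf x t).neg.const_mul c).add
      ((hasDerivAt_convolution_space hwx.continuous hwxx.continuous hdxx hf.continuous x t).sub
        ((hdiag x).mul (hneg hdf x t)))
  · have hslice : ∀ {k : ℝ → ℝ → ℝ}, Continuous (Function.uncurry k) → Continuous (k x) :=
      fun hk => hk.comp (by fun_prop : Continuous fun s => (x, s))
    have hc := hslice hw.continuous
    have hcs := hslice hws.continuous
    have hcss := hslice hwss.continuous
    have hcxx := hslice hwxx.continuous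
    have hfc := hf.continuous
    have hfc1 := hf1.continuous
    have parts1 := integral_mul_deriv_eq_deriv_mul (a := x) (b := t) (u := w x)
      (v := fun s => -deriv f (t - s)) (fun s _ => hds x s)
      (fun s _ => (hneg hddf s t).neg) (hcs.intervalIntegrable _ _)
      ((by fun_prop : Continuous fun s => - -deriv (deriv f) (t - s)).intervalIntegrable _ _)
    have parts2 := integral_mul_deriv_eq_deriv_mul (a := x) (b := t) (u := ws x)
      (v := fun s => f (t - s)) (fun s _ => hdss x s)
      (fun s _ => hneg hdf s t) (hcss.intervalIntegrable _ _)
      ((by fun_prop : Continuous fun s => -deriv f (t - s)).intervalIntegrable _ _)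
    have hG : (∫ s in x..t, wss x s * f (t - s)) - (∫ s in x..t, wxx x s * f (t - s))
        + q x * (∫ s in x..t, w x s * f (t - s)) = 0 := by
      rw [← integral_sub, ← integral_const_mul, ← integral_add]
      · rw [← integral_zero (a := x) (b := t)]
        refine integral_congr_Ioo_of_le hxt.le fun s hs => ?_
        have h := hgoursat x s hx hs.1
        rw [show deriv (w x) = ws x from funext fun s => (hds x s).deriv, (hdss x s).deriv,
          show (fun y => deriv (fun z => w z s) y) = fun y => wx y s from
            funext fun y => (hdx y s).deriv, (hdxx x s).deriv] at h
        linear_combination f (t - s) * h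
      all_goals exact Continuous.intervalIntegrable (by fun_prop) _ _
    have hD := hchar x hx
    rw [(hdiag x).deriv] at hD
    simp only [sub_self, hdf0, hf0 0 le_rfl, neg_neg, neg_zero, mul_zero] at parts1 parts2 ⊢
    linear_combination parts1 - parts2 + hG + f (t - x) * hD

/-- Representation of the solution of the wave equation with potential `q` on the
half-line `x > 0` driven by a control at the origin: if the kernels `w₁, w₂`
solve the Goursat problems with characteristic conditions
`(d/dx)[w₁(x,x)] = −q(x)/4`, `(d/dx)[w₂(x,x)] = q(x)/4`, then
`u(x,t) = ½f₁(t−x) − ½f₂(t−x) + ∫_x^t (w₁(x,s)f₁(t−s) + w₂(x,s)f₂(t−s)) ds`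
satisfies `u_tt − u_xx + q u = 0` for `0 < x < t` and vanishes for `0 < t < x`. -/
theorem stmt4 (q : ℝ → ℝ) (hq : ContinuousOn q (Ici 0))
    (f₁ f₂ : ℝ → ℝ)
    (hf₁ : ContDiff ℝ (⊤ : ℕ∞) f₁) (hf₂ : ContDiff ℝ (⊤ : ℕ∞) f₂)
    (hf₁0 : ∀ t ≤ (0 : ℝ), f₁ t = 0) (hf₂0 : ∀ t ≤ (0 : ℝ), f₂ t = 0)
    (w₁ w₂ : ℝ → ℝ → ℝ)
    (hw₁ : ContDiff ℝ 2 (Function.uncurry w₁))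
    (hw₂ : ContDiff ℝ 2 (Function.uncurry w₂))
    -- Goursat equations `(wᵢ)_ss − (wᵢ)_xx + q wᵢ = 0` for `0 < x < s`
    (hgoursat₁ : ∀ x s : ℝ, 0 < x → x < s →
      deriv (deriv (w₁ x)) s - deriv (fun y => deriv (fun z => w₁ z s) y) x
        + q x * w₁ x s = 0)
    (hgoursat₂ : ∀ x s : ℝ, 0 < x → x < s →
      deriv (deriv (w₂ x)) s - deriv (fun y => deriv (fun z => w₂ z s) y) x
        + q x * w₂ x s = 0)
    -- characteristic conditions on the diagonal
    (hchar₁ : ∀ x : ℝ, 0 < x → deriv (fun y => w₁ y y) x = -(q x) / 4)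
    (hchar₂ : ∀ x : ℝ, 0 < x → deriv (fun y => w₂ y y) x = q x / 4)
    (u : ℝ → ℝ → ℝ)
    (hu : ∀ x t : ℝ, 0 < x →
      u x t = (1 / 2) * f₁ (t - x) - (1 / 2) * f₂ (t - x)
        + ∫ s in x..t, (w₁ x s * f₁ (t - s) + w₂ x s * f₂ (t - s))) :
    (∀ x t : ℝ, 0 < x → x < t →
      deriv (fun τ => deriv (fun σ => u x σ) τ) t
        - deriv (fun y => deriv (fun z => u z t) y) x
        + q x * u x t = 0) ∧
    ∀ x t : ℝ, 0 < t → t < x → u x t = 0 := by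
  refine ⟨fun x t hx hxt => ?_, fun x t ht htx => ?_⟩
  · obtain ⟨At, Att, Ax, Axx, hAt, hAtt, hAx, hAxx, hA⟩ := exists_wave_derivs (q := q)
      (c := 1 / 2) (mod_cast contDiff_infty.1 hf₁ 2) hf₁0 hw₁ hgoursat₁
      (fun x hx => by rw [hchar₁ x hx]; ring) (fun _ _ => rfl)
    obtain ⟨Bt, Btt, Bx, Bxx, hBt, hBtt, hBx, hBxx, hB⟩ := exists_wave_derivs (q := q)
      (c := -(1 / 2)) (mod_cast contDiff_infty.1 hf₂ 2) hf₂0 hw₂ hgoursat₂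
      (fun x hx => by rw [hchar₂ x hx]; ring) (fun _ _ => rfl)
    have hsplit : ∀ y τ, 0 < y → u y τ =
        (1 / 2 * f₁ (τ - y) + ∫ s in y..τ, w₁ y s * f₁ (τ - s)) +
          (-(1 / 2) * f₂ (τ - y) + ∫ s in y..τ, w₂ y s * f₂ (τ - s)) := by
      intro y τ hy
      have h₁ : Continuous (w₁ y) := hw₁.continuous.comp (by fun_prop : Continuous fun s => (y, s))
      have h₂ : Continuous (w₂ y) := hw₂.continuous.comp (by fun_prop : Continuous fun s => (y, s))
      have h₃ := hf₁.continuous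
      have h₄ := hf₂.continuous
      rw [hu y τ hy, integral_add]
      · ring
      all_goals exact Continuous.intervalIntegrable (by fun_prop) _ _
    have ht : (fun τ => deriv (fun σ => u x σ) τ) = At x + Bt x := by
      funext τ
      rw [show (fun σ => u x σ) = _ from funext fun σ => hsplit x σ hx]
      exact ((hAt x τ).add (hBt x τ)).deriv
    have hxe : (fun y => deriv (fun z => u z t) y) =ᶠ[𝓝 x] (fun y => Ax y t) + fun y => Bx y t := by
      filter_upwards [Ioi_mem_nhds hx] with y hy
      refine (((hAx y t).add (hBx y t)).congr_of_eventuallyEq ?_).deriv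
      filter_upwards [Ioi_mem_nhds hy] with z hz using hsplit z t hz
    rw [ht, ((hAtt x t).add (hBtt x t)).deriv, hxe.deriv_eq,
      ((hAxx x t).add (hBxx x t)).deriv, hsplit x t hx]
    linear_combination hA x t hx hxt + hB x t hx hxt
  · have h : ∫ s in x..t, (w₁ x s * f₁ (t - s) + w₂ x s * f₂ (t - s)) = 0 := by
      rw [← integral_zero (a := x) (b := t)]
      refine integral_congr fun s hs => ?_
      rw [uIcc_of_ge htx.le] at hs
      simp [hf₁0 (t - s) (by linarith [hs.1]), hf₂0 (t - s) (by linarith [hs.1])]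
    rw [hu x t (ht.trans htx), h, hf₁0 (t - x) (by linarith), hf₂0 (t - x) (by linarith)]
    ring
end

section
/- Let f₁, f₂ : ℝ → ℝ be smooth functions vanishing on (-∞,0]. Let w₁, w₂ be continuously differentiable on {(x,s) : 0 ≤ x ≤ s} and on {(x,s) : x ≤ 0, −x ≤ s}, continuous together with their x-derivatives across x = 0, with common values wᵢ(0,s) and (wᵢ)_x(0,s). Define u(x,t) = (1/2)f₁(t−x) − (1/2)f₂(t−x) + ∫_x^t (w₁(x,s)f₁(t−s) + w₂(x,s)f₂(t−s)) ds for x > 0 and u(x,t) = −(1/2)f₁(t+x) − (1/2)f₂(t+x) + ∫_{−x}^t (w₁(x,s)f₁(t−s) + w₂(x,s)f₂(t−s)) ds for x < 0. Then for every t > 0, Γ₁u(·,t) = ( −(1/2)f₁'(t) + ∫_0^t ((w₁)_x(0,s)f₁(t−s) + (w₂)_x(0,s)f₂(t−s)) ds , (1/2)f₂(t) − ∫_0^t (w₁(0,s)f₁(t−s) + w₂(0,s)f₂(t−s)) ds ). -/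
open Set Filter Topology intervalIntegral

theorem continuous_integral_lower_limit {G : ℝ → ℝ → ℝ}
    (hG : Continuous (Function.uncurry G)) (t : ℝ) :
    Continuous fun p : ℝ × ℝ => ∫ s in p.2..t, G p.1 s := by
  have h : (fun p : ℝ × ℝ => ∫ s in p.2..t, G p.1 s) = fun p => -∫ s in t..p.2, G p.1 s :=
    funext fun p => integral_symm t p.2
  rw [h]
  exact (continuous_parametric_intervalIntegral_of_continuous (f := fun p : ℝ × ℝ => G p.1)
    (by fun_prop) continuous_snd).neg

/-- Leibniz rule for an integral whose lower limit and integrand both depend on the parameter. -/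
theorem hasDerivAt_integral_lower_limit {G G' : ℝ → ℝ → ℝ}
    (hG : Continuous (Function.uncurry G)) (hG' : Continuous (Function.uncurry G'))
    (hder : ∀ x s, HasDerivAt (fun y => G y s) (G' x s) x) (σ t x : ℝ) :
    HasDerivAt (fun y => ∫ s in (σ * y)..t, G y s)
      ((∫ s in (σ * x)..t, G' x s) - σ * G x (σ * x)) x := by
  have hcont : ∀ y, Continuous (G y) := fun y => by fun_prop
  have hcont' : ∀ y, Continuous (G' y) := fun y => by fun_prop
  have hfst : ∀ y a : ℝ, HasDerivAt (fun z => ∫ s in a..t, G z s) (∫ s in a..t, G' y s) y := by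
    intro y a
    obtain ⟨C, hC⟩ := ((isCompact_closedBall y 1).prod isCompact_uIcc :
      IsCompact (Metric.closedBall y 1 ×ˢ uIcc a t)).exists_bound_of_continuousOn hG'.continuousOn
    refine (hasDerivAt_integral_of_dominated_loc_of_deriv_le (bound := fun _ => C)
      (Metric.closedBall_mem_nhds y one_pos)
      (Eventually.of_forall fun z => (hcont z).aestronglyMeasurable)
      ((hcont y).intervalIntegrable _ _) (hcont' y).aestronglyMeasurable
      (Eventually.of_forall fun s hs z hz => hC (z, s) ⟨hz, uIoc_subset_uIcc hs⟩)
      intervalIntegrable_const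
      (Eventually.of_forall fun s _ z _ => hder z s)).2
  have hsnd : ∀ y a : ℝ, HasDerivAt (fun b => ∫ s in b..t, G y s) (-G y a) a := fun y a =>
    integral_hasDerivAt_left ((hcont y).intervalIntegrable _ _)
      (hcont y).aestronglyMeasurable.stronglyMeasurableAtFilter (hcont y).continuousAt
  have hint := continuous_integral_lower_limit hG' t
  have hstrict := hasStrictFDerivAt_uncurry_coprod (𝕜 := ℝ) (u := (x, σ * x))
    (f := fun y a => ∫ s in a..t, G y s)
    (f₁ := fun y a => ContinuousLinearMap.toSpanSingleton ℝ (∫ s in a..t, G' y s))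
    (f₂ := fun y a => ContinuousLinearMap.toSpanSingleton ℝ (-G y a))
    (Eventually.of_forall fun v => (hfst v.1 v.2).hasFDerivAt)
    (Eventually.of_forall fun v => (hsnd v.1 v.2).hasFDerivAt)
    ((ContinuousLinearMap.toSpanSingletonCLE (𝕜 := ℝ) (E := ℝ)).continuous.comp hint).continuousAt
    ((ContinuousLinearMap.toSpanSingletonCLE (𝕜 := ℝ) (E := ℝ)).continuous.comp
      hG.neg).continuousAt
  have hcurve : HasDerivAt (fun y : ℝ => (y, σ * y)) (1, σ) x :=
    (hasDerivAt_id x).prodMk (by simpa using (hasDerivAt_id x).const_mul σ)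
  refine (hstrict.hasFDerivAt.comp_hasDerivAt x hcurve).congr_deriv ?_
  simp [Function.HasUncurry.uncurry]
  ring

/-- Limits at the origin, along an open set, of a function given by a `C¹` term plus an integral
with moving lower limit, and of its derivative. -/
theorem tendsto_and_tendsto_deriv_of_eqOn {G G' : ℝ → ℝ → ℝ} {g g' v : ℝ → ℝ} {S : Set ℝ}
    (hG : Continuous (Function.uncurry G)) (hG' : Continuous (Function.uncurry G'))
    (hder : ∀ x s, HasDerivAt (fun y => G y s) (G' x s) x)
    (hg : ∀ x, HasDerivAt g (g' x) x) (hg' : Continuous g') (hS : IsOpen S) (σ t : ℝ)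
    (hv : ∀ x ∈ S, v x = g x + ∫ s in (σ * x)..t, G x s) :
    Tendsto v (𝓝[S] 0) (𝓝 (g 0 + ∫ s in (0 : ℝ)..t, G 0 s)) ∧
      Tendsto (deriv v) (𝓝[S] 0) (𝓝 (g' 0 + ((∫ s in (0 : ℝ)..t, G' 0 s) - σ * G 0 0))) := by
  have hF : ∀ x, HasDerivAt (fun y => g y + ∫ s in (σ * y)..t, G y s)
      (g' x + ((∫ s in (σ * x)..t, G' x s) - σ * G x (σ * x))) x := fun x =>
    (hg x).add (hasDerivAt_integral_lower_limit hG hG' hder σ t x)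
  have hint : Continuous fun x : ℝ => ∫ s in (σ * x)..t, G' x s :=
    (continuous_integral_lower_limit hG' t).comp
      (by fun_prop : Continuous fun x : ℝ => (x, σ * x))
  have hF' : Continuous fun x => g' x + ((∫ s in (σ * x)..t, G' x s) - σ * G x (σ * x)) := by
    fun_prop
  constructor
  · have h := (hF 0).continuousAt.tendsto.mono_left (nhdsWithin_le_nhds (s := S))
    rw [mul_zero] at h
    exact h.congr' (eventually_nhdsWithin_of_forall fun x hx => (hv x hx).symm)
  · have h := (hF'.tendsto 0).mono_left (nhdsWithin_le_nhds (s := S))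
    rw [mul_zero] at h
    refine h.congr' (eventually_nhdsWithin_of_forall fun x hx => ?_)
    exact ((hF x).congr_of_eventuallyEq
      (Filter.eventuallyEq_of_mem (hS.mem_nhds hx) hv)).deriv.symm

theorem hasDerivAt_fst_of_contDiff {w : ℝ → ℝ → ℝ} (hw : ContDiff ℝ 1 (Function.uncurry w))
    (x s : ℝ) : HasDerivAt (fun y => w y s) (fderiv ℝ (Function.uncurry w) (x, s) (1, 0)) x :=
  HasFDerivAt.comp_hasDerivAt (f := fun y => (y, s)) x
    (hw.differentiable one_ne_zero).differentiableAt.hasFDerivAt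
    ((hasDerivAt_id' x).prodMk (hasDerivAt_const x s))

theorem continuous_uncurry_deriv_fst {w : ℝ → ℝ → ℝ} (hw : ContDiff ℝ 1 (Function.uncurry w)) :
    Continuous (Function.uncurry fun x s => deriv (fun y => w y s) x) := by
  have h : (Function.uncurry fun x s => deriv (fun y => w y s) x) =
      fun p => fderiv ℝ (Function.uncurry w) p (1, 0) :=
    funext fun p => (hasDerivAt_fst_of_contDiff hw p.1 p.2).deriv
  rw [h]
  exact (hw.continuous_fderiv one_ne_zero).clm_apply continuous_const

/-- One-sided limits at the origin of a function, and of its derivative, given by the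
representation formula on an open set. -/
theorem tendsto_and_tendsto_deriv_representation {f₁ f₂ v : ℝ → ℝ} {w₁ w₂ : ℝ → ℝ → ℝ}
    {S : Set ℝ} (hf₁ : ContDiff ℝ 1 f₁) (hf₂ : ContDiff ℝ 1 f₂)
    (hw₁ : ContDiff ℝ 1 (Function.uncurry w₁)) (hw₂ : ContDiff ℝ 1 (Function.uncurry w₂))
    (hS : IsOpen S) (α β σ t : ℝ)
    (hv : ∀ x ∈ S, v x = (α * f₁ (t - σ * x) + β * f₂ (t - σ * x)) +
      ∫ s in (σ * x)..t, (w₁ x s * f₁ (t - s) + w₂ x s * f₂ (t - s))) :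
    Tendsto v (𝓝[S] 0) (𝓝 (α * f₁ t + β * f₂ t +
        ∫ s in (0 : ℝ)..t, (w₁ 0 s * f₁ (t - s) + w₂ 0 s * f₂ (t - s)))) ∧
      Tendsto (deriv v) (𝓝[S] 0) (𝓝 (-σ * (α * deriv f₁ t + β * deriv f₂ t) +
        ((∫ s in (0 : ℝ)..t, (deriv (fun y => w₁ y s) 0 * f₁ (t - s) +
            deriv (fun y => w₂ y s) 0 * f₂ (t - s))) -
          σ * (w₁ 0 0 * f₁ t + w₂ 0 0 * f₂ t)))) := by
  have hc₁ := hf₁.continuous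
  have hc₂ := hf₂.continuous
  have hd₁ := hf₁.continuous_deriv le_rfl
  have hd₂ := hf₂.continuous_deriv le_rfl
  have hwc₁ := hw₁.continuous
  have hwc₂ := hw₂.continuous
  have hwd₁ := continuous_uncurry_deriv_fst hw₁
  have hwd₂ := continuous_uncurry_deriv_fst hw₂
  have hshift : ∀ {f : ℝ → ℝ}, ContDiff ℝ 1 f → ∀ x,
      HasDerivAt (fun y => f (t - σ * y)) (-σ * deriv f (t - σ * x)) x := by
    intro f hf x
    have hin : HasDerivAt (fun y => t - σ * y) (-σ) x := by
      simpa using ((hasDerivAt_id x).const_mul σ).const_sub t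
    have h := ((hf.differentiable one_ne_zero).differentiableAt.hasDerivAt
      (x := t - σ * x)).comp x hin
    exact h.congr_deriv (mul_comm _ _)
  have hmain := tendsto_and_tendsto_deriv_of_eqOn
    (G := fun x s => w₁ x s * f₁ (t - s) + w₂ x s * f₂ (t - s))
    (G' := fun x s => deriv (fun y => w₁ y s) x * f₁ (t - s) +
      deriv (fun y => w₂ y s) x * f₂ (t - s))
    (g := fun x => α * f₁ (t - σ * x) + β * f₂ (t - σ * x))
    (g' := fun x => -σ * (α * deriv f₁ (t - σ * x) + β * deriv f₂ (t - σ * x)))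
    ((hwc₁.mul (by fun_prop : Continuous fun p : ℝ × ℝ => f₁ (t - p.2))).add
      (hwc₂.mul (by fun_prop : Continuous fun p : ℝ × ℝ => f₂ (t - p.2))))
    ((hwd₁.mul (by fun_prop : Continuous fun p : ℝ × ℝ => f₁ (t - p.2))).add
      (hwd₂.mul (by fun_prop : Continuous fun p : ℝ × ℝ => f₂ (t - p.2))))
    (fun x s => ((hasDerivAt_fst_of_contDiff hw₁ x s).differentiableAt.hasDerivAt.mul_const _).add
      ((hasDerivAt_fst_of_contDiff hw₂ x s).differentiableAt.hasDerivAt.mul_const _))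
    (fun x => (((hshift hf₁ x).const_mul α).add ((hshift hf₂ x).const_mul β)).congr_deriv
      (by ring))
    (by fun_prop) hS σ t hv
  simpa only [mul_zero, sub_zero] using hmain

/-- The value of the response operator (dynamic Dirichlet-to-Neumann map):
for the representation formula with kernels continuous, together with their
`x`-derivatives, across `x = 0`,
`Γ₁u(·,t) = ( −½f₁'(t) + ∫_0^t ((w₁)_x(0,s)f₁(t−s) + (w₂)_x(0,s)f₂(t−s)) ds ,
              ½f₂(t) − ∫_0^t (w₁(0,s)f₁(t−s) + w₂(0,s)f₂(t−s)) ds )`,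
where `Γ₁u = ((u'₊ + u'₋)/2, −(u₊ + u₋)/2)` at the origin. -/
theorem stmt7 (f₁ f₂ : ℝ → ℝ)
    (hf₁ : ContDiff ℝ (⊤ : ℕ∞) f₁) (hf₂ : ContDiff ℝ (⊤ : ℕ∞) f₂)
    (hf₁0 : ∀ t ≤ (0 : ℝ), f₁ t = 0) (hf₂0 : ∀ t ≤ (0 : ℝ), f₂ t = 0)
    (w₁p w₂p w₁m w₂m : ℝ → ℝ → ℝ)
    (hw₁p : ContDiff ℝ 1 (Function.uncurry w₁p))
    (hw₂p : ContDiff ℝ 1 (Function.uncurry w₂p))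
    (hw₁m : ContDiff ℝ 1 (Function.uncurry w₁m))
    (hw₂m : ContDiff ℝ 1 (Function.uncurry w₂m))
    -- common values of the kernels across `x = 0`
    (hmatch₁ : ∀ s : ℝ, 0 ≤ s → w₁p 0 s = w₁m 0 s)
    (hmatch₂ : ∀ s : ℝ, 0 ≤ s → w₂p 0 s = w₂m 0 s)
    -- common values of the `x`-derivatives of the kernels across `x = 0`
    (hmatch₁x : ∀ s : ℝ, 0 ≤ s →
      deriv (fun y => w₁p y s) 0 = deriv (fun y => w₁m y s) 0)
    (hmatch₂x : ∀ s : ℝ, 0 ≤ s →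
      deriv (fun y => w₂p y s) 0 = deriv (fun y => w₂m y s) 0)
    (u : ℝ → ℝ → ℝ)
    (huP : ∀ x t : ℝ, 0 < x →
      u x t = (1 / 2) * f₁ (t - x) - (1 / 2) * f₂ (t - x)
        + ∫ s in x..t, (w₁p x s * f₁ (t - s) + w₂p x s * f₂ (t - s)))
    (huM : ∀ x t : ℝ, x < 0 →
      u x t = -(1 / 2) * f₁ (t + x) - (1 / 2) * f₂ (t + x)
        + ∫ s in (-x)..t, (w₁m x s * f₁ (t - s) + w₂m x s * f₂ (t - s))) :
    ∀ t : ℝ, 0 < t → ∃ a b c d : ℝ,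
      Tendsto (fun x => u x t) (𝓝[>] 0) (𝓝 a) ∧
      Tendsto (fun x => u x t) (𝓝[<] 0) (𝓝 b) ∧
      Tendsto (fun x => deriv (fun z => u z t) x) (𝓝[>] 0) (𝓝 c) ∧
      Tendsto (fun x => deriv (fun z => u z t) x) (𝓝[<] 0) (𝓝 d) ∧
      (c + d) / 2
        = -(1 / 2) * deriv f₁ t
          + ∫ s in (0:ℝ)..t,
              (deriv (fun y => w₁p y s) 0 * f₁ (t - s)
                + deriv (fun y => w₂p y s) 0 * f₂ (t - s)) ∧
      -(a + b) / 2
        = (1 / 2) * f₂ t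
          - ∫ s in (0:ℝ)..t, (w₁p 0 s * f₁ (t - s) + w₂p 0 s * f₂ (t - s)) := by
  intro t ht
  have hf₁1 : ContDiff ℝ 1 f₁ := hf₁.of_le (by exact_mod_cast le_top)
  have hf₂1 : ContDiff ℝ 1 f₂ := hf₂.of_le (by exact_mod_cast le_top)
  obtain ⟨ha, hc⟩ := tendsto_and_tendsto_deriv_representation (v := fun x => u x t) (S := Ioi 0)
    hf₁1 hf₂1 hw₁p hw₂p isOpen_Ioi (1 / 2) (-(1 / 2)) 1 t
    (fun x hx => by rw [huP x t hx, one_mul]; ring)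
  obtain ⟨hb, hd⟩ := tendsto_and_tendsto_deriv_representation (v := fun x => u x t) (S := Iio 0)
    hf₁1 hf₂1 hw₁m hw₂m isOpen_Iio (-(1 / 2)) (-(1 / 2)) (-1) t
    (fun x hx => by rw [huM x t hx, neg_one_mul, sub_neg_eq_add]; ring)
  have hnonneg : ∀ s ∈ uIcc 0 t, 0 ≤ s := fun s hs => (uIcc_of_le ht.le ▸ hs).1
  have hI : ∫ s in (0 : ℝ)..t, (w₁m 0 s * f₁ (t - s) + w₂m 0 s * f₂ (t - s)) =
      ∫ s in (0 : ℝ)..t, (w₁p 0 s * f₁ (t - s) + w₂p 0 s * f₂ (t - s)) :=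
    integral_congr fun s hs => by
      simp only [hmatch₁ s (hnonneg s hs), hmatch₂ s (hnonneg s hs)]
  have hI' : ∫ s in (0 : ℝ)..t, (deriv (fun y => w₁m y s) 0 * f₁ (t - s) +
        deriv (fun y => w₂m y s) 0 * f₂ (t - s)) =
      ∫ s in (0 : ℝ)..t, (deriv (fun y => w₁p y s) 0 * f₁ (t - s) +
        deriv (fun y => w₂p y s) 0 * f₂ (t - s)) :=
    integral_congr fun s hs => by
      simp only [hmatch₁x s (hnonneg s hs), hmatch₂x s (hnonneg s hs)]
  rw [hI] at hb
  rw [hI', ← hmatch₁ 0 le_rfl, ← hmatch₂ 0 le_rfl] at hd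
  exact ⟨_, _, _, _, ha, hb, hc, hd, by ring, by ring⟩
end

section
/- Let T > 0, let r : [0,2T] → ℝ be continuous, and let g : [0,2T] → ℝ be continuous with g(2T−s) = −g(s) for all s ∈ [0,2T] (odd with respect to s = T). Set p(s) = ∫_0^s r(α) dα. Then for every τ ∈ [0,T]: ∫_τ^{2T−τ} ∫_0^σ r(s) g(σ−s) ds dσ = ∫_0^T ( p(2T−τ−α) − p(|τ−α|) ) g(α) dα. -/
open Set intervalIntegral

open MeasureTheory in
/-- Fubini's theorem on the triangle `{(x, y) | a ≤ y ≤ x ≤ b}`. -/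
theorem integral_integral_swap_triangle {E : Type*} [NormedAddCommGroup E] [NormedSpace ℝ E]
    {f : ℝ → ℝ → E} (hf : Continuous f.uncurry) {a b : ℝ} (hab : a ≤ b) :
    (∫ x in a..b, ∫ y in a..x, f x y) = ∫ y in a..b, ∫ x in y..b, f x y := by
  let F : ℝ → ℝ → E := fun x y ↦ {z : ℝ × ℝ | z.2 ≤ z.1}.indicator f.uncurry (x, y)
  have hF : IntegrableOn F.uncurry (uIoc a b ×ˢ uIoc a b) := by
    have hm : MeasurableSet {z : ℝ × ℝ | z.2 ≤ z.1} := measurableSet_le measurable_snd measurable_fst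
    have hc : IntegrableOn f.uncurry (uIcc a b ×ˢ uIcc a b) :=
      hf.continuousOn.integrableOn_compact (isCompact_uIcc.prod isCompact_uIcc)
    exact (hc.mono_set (prod_mono uIoc_subset_uIcc uIoc_subset_uIcc)).indicator hm
  have hx : ∀ x ∈ uIcc a b, ∫ y in a..b, F x y = ∫ y in a..x, f x y := by
    intro x hx
    rw [uIcc_of_le hab] at hx
    rw [integral_of_le hab, integral_of_le hx.1]
    have : F x = (Iic x).indicator (f x) := by
      ext y
      simp [F, indicator_apply]
    rw [this, setIntegral_indicator measurableSet_Iic, Ioc_inter_Iic, min_eq_right hx.2]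
  have hy : ∀ y ∈ uIcc a b, ∫ x in a..b, F x y = ∫ x in y..b, f x y := by
    intro y hy
    rw [uIcc_of_le hab] at hy
    rw [integral_of_le hab, integral_of_le hy.2, ← integral_Icc_eq_integral_Ioc,
      ← integral_Icc_eq_integral_Ioc]
    have : (fun x ↦ F x y) = (Ici y).indicator (fun x ↦ f x y) := by
      ext x
      simp [F, indicator_apply]
    have hinter : Icc a b ∩ Ici y = Icc y b := by
      ext x
      exact ⟨fun h ↦ ⟨h.2, h.1.2⟩, fun h ↦ ⟨⟨hy.1.trans h.1, h.2⟩, h.1⟩⟩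
    rw [this, setIntegral_indicator measurableSet_Ici, hinter]
  rw [← integral_congr hx, ← integral_congr hy]
  exact intervalIntegral_intervalIntegral_swap hF

/-- The primitive of the Volterra convolution `r * g` is the Volterra convolution of the primitive
of `r` with `g`. -/
theorem integral_volterra_convolution {r g : ℝ → ℝ} (hr : Continuous r) (hg : Continuous g)
    {x : ℝ} (hx : 0 ≤ x) :
    (∫ σ in (0:ℝ)..x, ∫ s in (0:ℝ)..σ, r s * g (σ - s)) =
      ∫ α in (0:ℝ)..x, (∫ s in (0:ℝ)..(x - α), r s) * g α := by
  have h : ∀ σ : ℝ, ∫ s in (0:ℝ)..σ, r s * g (σ - s) = ∫ α in (0:ℝ)..σ, r (σ - α) * g α := by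
    intro σ
    simpa using (integral_comp_sub_left (a := 0) (b := σ) (fun s ↦ r (σ - s) * g s) σ)
  simp_rw [h]
  rw [integral_integral_swap_triangle (f := fun σ α ↦ r (σ - α) * g α) (by fun_prop) hx]
  refine integral_congr fun α _ ↦ ?_
  simp [integral_comp_sub_right]

/-- The identity for the `(1,1)`-entry of the connecting-operator kernel when `r` and `g` are
continuous on the whole line. -/
theorem integral_connecting_kernel_of_continuous {T : ℝ} {r g p : ℝ → ℝ} (hr : Continuous r)
    (hg : Continuous g) (hgodd : ∀ s ∈ Icc (0:ℝ) (2 * T), g (2 * T - s) = -g s)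
    (hp : ∀ s : ℝ, p s = ∫ α in (0:ℝ)..s, r α) {τ : ℝ} (hτ : τ ∈ Icc 0 T) :
    (∫ σ in τ..(2 * T - τ), ∫ s in (0:ℝ)..σ, r s * g (σ - s))
      = ∫ α in (0:ℝ)..T, (p (2 * T - τ - α) - p |τ - α|) * g α := by
  obtain ⟨h0, h1⟩ := hτ
  have hpc : Continuous p := by
    rw [funext hp]
    exact continuous_primitive (fun a b ↦ hr.intervalIntegrable a b) 0
  have hF : Continuous fun σ ↦ ∫ s in (0:ℝ)..σ, r s * g (σ - s) :=
    continuous_parametric_intervalIntegral_of_continuous (by fun_prop) continuous_id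
  have int : ∀ {f : ℝ → ℝ}, Continuous f → ∀ a b, IntervalIntegrable f MeasureTheory.volume a b :=
    fun hf a b ↦ hf.intervalIntegrable a b
  have hq : Continuous fun α ↦ p (2 * T - τ - α) * g α := by fun_prop
  have ha : Continuous fun α ↦ p |τ - α| * g α := by fun_prop
  rw [← integral_interval_sub_left (int hF 0 _) (int hF 0 _),
    integral_volterra_convolution hr hg (by linarith), integral_volterra_convolution hr hg h0]
  simp_rw [← hp, sub_mul]
  rw [integral_sub (int hq _ _) (int ha _ _), ← integral_add_adjacent_intervals (int hq 0 T)
    (int hq T _), ← integral_add_adjacent_intervals (int ha 0 τ) (int ha τ T)]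
  have hleft : ∫ α in (0:ℝ)..τ, p |τ - α| * g α = ∫ α in (0:ℝ)..τ, p (τ - α) * g α := by
    refine integral_congr fun α hα ↦ ?_
    rw [uIcc_of_le h0] at hα
    simp only [abs_of_nonneg (sub_nonneg.2 hα.2)]
  have hright : ∫ α in τ..T, p |τ - α| * g α = -∫ α in T..(2 * T - τ), p (2 * T - τ - α) * g α := by
    have hsub := integral_comp_sub_left (a := τ) (b := T)
      (fun α ↦ p (2 * T - τ - α) * g α) (2 * T)
    rw [show 2 * T - T = T by ring] at hsub
    rw [← hsub, ← integral_neg]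
    refine integral_congr fun α hα ↦ ?_
    rw [uIcc_of_le h1] at hα
    have : 2 * T - τ - (2 * T - α) = |τ - α| := by
      rw [abs_of_nonpos (sub_nonpos.2 hα.1)]
      ring
    simp only [this, hgodd α ⟨h0.trans hα.1, by linarith [hα.2]⟩, mul_neg, neg_neg]
  rw [hleft, hright]
  ring



/-- The `(1,1)`-entry of the connecting-operator kernel: for continuous
`r : [0,2T] → ℝ` and continuous `g` odd with respect to `s = T`, with
`p(s) = ∫_0^s r`, one has for every `τ ∈ [0,T]`:
`∫_τ^{2T−τ} ∫_0^σ r(s) g(σ−s) ds dσ = ∫_0^T (p(2T−τ−α) − p(|τ−α|)) g(α) dα`. -/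
theorem stmt10 (T : ℝ) (hT : 0 < T) (r g : ℝ → ℝ)
    (hr : ContinuousOn r (Icc 0 (2 * T)))
    (hg : ContinuousOn g (Icc 0 (2 * T)))
    (hgodd : ∀ s ∈ Icc (0:ℝ) (2 * T), g (2 * T - s) = -g s)
    (p : ℝ → ℝ) (hp : ∀ s : ℝ, p s = ∫ α in (0:ℝ)..s, r α) :
    ∀ τ ∈ Icc (0:ℝ) T,
      (∫ σ in τ..(2 * T - τ), ∫ s in (0:ℝ)..σ, r s * g (σ - s))
        = ∫ α in (0:ℝ)..T, (p (2 * T - τ - α) - p |τ - α|) * g α := by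
  rintro τ ⟨h0, h1⟩
  have hT2 : (0:ℝ) ≤ 2 * T := by linarith
  set R := IccExtend hT2 ((Icc 0 (2 * T)).domRestrict r)
  set G := IccExtend hT2 ((Icc 0 (2 * T)).domRestrict g)
  have hR : Continuous R := hr.domRestrict.Icc_extend'
  have hG : Continuous G := hg.domRestrict.Icc_extend'
  have eR : ∀ s ∈ Icc 0 (2 * T), R s = r s := fun s hs ↦ IccExtend_of_mem hT2 _ hs
  have eG : ∀ s ∈ Icc 0 (2 * T), G s = g s := fun s hs ↦ IccExtend_of_mem hT2 _ hs
  have hGodd : ∀ s ∈ Icc (0:ℝ) (2 * T), G (2 * T - s) = -G s := by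
    intro s hs
    rw [eG s hs, eG (2 * T - s) ⟨by linarith [hs.2], by linarith [hs.1]⟩, hgodd s hs]
  have hP : ∀ x ∈ Icc 0 (2 * T), p x = ∫ α in (0:ℝ)..x, R α := by
    intro x hx
    rw [hp]
    refine integral_congr fun s hs ↦ ?_
    rw [uIcc_of_le hx.1] at hs
    exact (eR s ⟨hs.1, hs.2.trans hx.2⟩).symm
  have main := integral_connecting_kernel_of_continuous hR hG hGodd
    (p := fun x ↦ ∫ α in (0:ℝ)..x, R α) (fun _ ↦ rfl) ⟨h0, h1⟩
  convert main using 1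
  · refine integral_congr fun σ hσ ↦ integral_congr fun s hs ↦ ?_
    rw [uIcc_of_le (by linarith)] at hσ
    rw [uIcc_of_le (h0.trans hσ.1)] at hs
    obtain ⟨hσ1, hσ2⟩ := hσ
    obtain ⟨hs1, hs2⟩ := hs
    simp only [eR s ⟨hs1, by linarith⟩, eG (σ - s) ⟨by linarith, by linarith⟩]
  · refine integral_congr fun α hα ↦ ?_
    rw [uIcc_of_le (h0.trans h1)] at hα
    obtain ⟨hα1, hα2⟩ := hα
    have habs : |τ - α| ≤ 2 * T := abs_le.2 ⟨by linarith, by linarith⟩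
    simp only [hP (2 * T - τ - α) ⟨by linarith, by linarith⟩, hP |τ - α| ⟨abs_nonneg _, habs⟩,
      eG α ⟨hα1, by linarith⟩]
end

section
/- Let T > 0, let r : [0,2T] → ℝ be continuous, and let g : [0,2T] → ℝ be continuous with g(2T−s) = g(s) for all s ∈ [0,2T] (even with respect to s = T). Set p(s) = ∫_0^s r(α) dα for s ≥ 0, and let p̃ : ℝ → ℝ be the odd extension p̃(s) = p(s) for s ≥ 0, p̃(s) = −p(−s) for s < 0. Then for every τ ∈ [0,T]: ∫_τ^{2T−τ} ∫_0^σ r(s) g(σ−s) ds dσ = ∫_0^T ( p̃(2T−τ−α) − p̃(τ−α) ) g(α) dα. -/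
open Set intervalIntegral

/-- Interchange of the order of integration over the triangle `0 ≤ α ≤ σ ≤ x`. -/
theorem integral_integral_triangle_swap {F : ℝ → ℝ → ℝ} (hF : Continuous F.uncurry) {x : ℝ}
    (hx : 0 ≤ x) :
    ∫ σ in (0:ℝ)..x, ∫ α in (0:ℝ)..σ, F σ α = ∫ α in (0:ℝ)..x, ∫ σ in α..x, F σ α := by
  have hswap := MeasureTheory.intervalIntegral_intervalIntegral_swap (a := 0) (b := x) (c := 0)
    (d := x) (F := fun σ α => {z : ℝ × ℝ | z.2 ≤ z.1}.indicator F.uncurry (σ, α)) <| by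
    have hmeas : MeasurableSet {z : ℝ × ℝ | z.2 ≤ z.1} :=
      measurableSet_le measurable_snd measurable_fst
    refine MeasureTheory.IntegrableOn.indicator (f := F.uncurry) ?_ hmeas
    refine (hF.continuousOn.integrableOn_compact
      (isCompact_uIcc.prod isCompact_uIcc)).mono_set
      (prod_mono uIoc_subset_uIcc uIoc_subset_uIcc)
  convert hswap using 1
  · refine integral_congr fun σ hσ => ?_
    rw [uIcc_of_le hx] at hσ
    exact (integral_indicator (f := fun α => F σ α) hσ).symm
  · refine integral_congr_ae (Filter.Eventually.of_forall fun α hα => ?_)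
    rw [uIoc_of_le hx] at hα
    have hset : Ioc 0 x ∩ Ici α = Icc α x := by
      ext σ
      simp only [mem_inter_iff, mem_Ioc, mem_Ici, mem_Icc]
      exact ⟨fun h => ⟨h.2, h.1.2⟩, fun h => ⟨⟨hα.1.trans_le h.1, h.2⟩, h.1⟩⟩
    rw [integral_of_le hα.2, integral_of_le hx, ← MeasureTheory.integral_Icc_eq_integral_Ioc,
      ← hset, ← MeasureTheory.setIntegral_indicator measurableSet_Ici]
    rfl

/-- The integral of the convolution `r * g` is the convolution of the primitive of `r` with `g`. -/
theorem integral_convolution_eq {r g : ℝ → ℝ} (hr : Continuous r) (hg : Continuous g) {x : ℝ}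
    (hx : 0 ≤ x) :
    ∫ σ in (0:ℝ)..x, ∫ s in (0:ℝ)..σ, r s * g (σ - s)
      = ∫ α in (0:ℝ)..x, (∫ s in (0:ℝ)..(x - α), r s) * g α := by
  have hreflect (σ : ℝ) :
      ∫ s in (0:ℝ)..σ, r s * g (σ - s) = ∫ α in (0:ℝ)..σ, r (σ - α) * g α := by
    simpa using (integral_comp_sub_left (a := 0) (b := σ) (fun α => r (σ - α) * g α) σ)
  simp_rw [hreflect]
  rw [integral_integral_triangle_swap (F := fun σ α => r (σ - α) * g α) (by fun_prop) hx]
  refine integral_congr fun α _ => ?_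
  simp only [integral_mul_const, integral_comp_sub_right (fun s => r s), sub_self]

theorem continuous_integral_convolution {r g : ℝ → ℝ} (hr : Continuous r) (hg : Continuous g) :
    Continuous fun σ : ℝ => ∫ s in (0:ℝ)..σ, r s * g (σ - s) :=
  continuous_parametric_intervalIntegral_of_continuous (by fun_prop) continuous_id

/-- The connecting-operator identity for globally continuous `r` and `g`, with the odd extension
of the primitive of `r` given by any `q` having its values on both half-lines. -/
theorem integral_convolution_eq_of_even {T τ : ℝ} {r g q : ℝ → ℝ} (hr : Continuous r)
    (hg : Continuous g) (hgeven : ∀ s ∈ Icc (0:ℝ) (2 * T), g (2 * T - s) = g s)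
    (hq : ∀ s, 0 ≤ s → q s = ∫ α in (0:ℝ)..s, r α)
    (hq_odd : ∀ s, s ≤ 0 → q s = -∫ α in (0:ℝ)..(-s), r α) (hτ : τ ∈ Icc 0 T) :
    (∫ σ in τ..(2 * T - τ), ∫ s in (0:ℝ)..σ, r s * g (σ - s))
      = ∫ α in (0:ℝ)..T, (q (2 * T - τ - α) - q (τ - α)) * g α := by
  obtain ⟨hτ0, hτT⟩ := hτ
  set P : ℝ → ℝ := fun s => ∫ α in (0:ℝ)..s, r α with hP
  have hPcont : Continuous P := continuous_primitive (fun a b => hr.intervalIntegrable a b) 0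
  have hqcont : Continuous q := by
    have : q = fun s => if 0 ≤ s then P s else -P (-s) := by
      funext s
      split_ifs with h
      · exact hq s h
      · exact hq_odd s (not_le.mp h).le
    rw [this]
    refine Continuous.if_le hPcont (by fun_prop) continuous_const continuous_id ?_
    rintro s rfl
    simp [hP]
  have hC := continuous_integral_convolution hr hg
  have hii {f : ℝ → ℝ} (hf : Continuous f) (a b : ℝ) :
      IntervalIntegrable f MeasureTheory.volume a b := hf.intervalIntegrable a b
  rw [← integral_interval_sub_left (hii hC 0 _) (hii hC 0 _),
    integral_convolution_eq hr hg (by linarith), integral_convolution_eq hr hg hτ0,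
    ← integral_add_adjacent_intervals (b := T)
      (hii (f := fun α => P (2 * T - τ - α) * g α) (by fun_prop) 0 T) (hii (by fun_prop) T _)]
  simp_rw [sub_mul]
  rw [integral_sub (hii (by fun_prop) _ _) (hii (by fun_prop) _ _),
    ← integral_add_adjacent_intervals (b := τ)
      (hii (f := fun α => q (τ - α) * g α) (by fun_prop) 0 τ) (hii (by fun_prop) τ T)]
  have hmain : ∫ α in (0:ℝ)..T, q (2 * T - τ - α) * g α
      = ∫ α in (0:ℝ)..T, P (2 * T - τ - α) * g α := by
    refine integral_congr fun α hα => ?_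
    rw [uIcc_of_le (hτ0.trans hτT)] at hα
    simp only [hq _ (show 0 ≤ 2 * T - τ - α by linarith [hα.2]), hP]
  have hleft : ∫ α in (0:ℝ)..τ, q (τ - α) * g α = ∫ α in (0:ℝ)..τ, P (τ - α) * g α := by
    refine integral_congr fun α hα => ?_
    rw [uIcc_of_le hτ0] at hα
    simp only [hq _ (sub_nonneg.2 hα.2), hP]
  have hright : ∫ α in T..(2 * T - τ), P (2 * T - τ - α) * g α
      = -∫ α in τ..T, q (τ - α) * g α := by
    have h := integral_comp_sub_left (a := τ) (b := T)
      (fun α => P (2 * T - τ - α) * g α) (2 * T)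
    rw [show 2 * T - T = T by ring] at h
    rw [← h, ← intervalIntegral.integral_neg]
    refine integral_congr fun α hα => ?_
    rw [uIcc_of_le hτT] at hα
    simp only [hq_odd _ (sub_nonpos.2 hα.1), hP,
      hgeven α ⟨hτ0.trans hα.1, by linarith [hα.2]⟩]
    rw [show 2 * T - τ - (2 * T - α) = -(τ - α) by ring]
    ring
  rw [hmain, hleft, hright]
  ring

/-- The `(1,2)`-entry of the connecting-operator kernel: for continuous
`r : [0,2T] → ℝ` and continuous `g` even with respect to `s = T`, with
`p(s) = ∫_0^s r` and `p̃` its odd extension, one has for every `τ ∈ [0,T]`: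
`∫_τ^{2T−τ} ∫_0^σ r(s) g(σ−s) ds dσ = ∫_0^T (p̃(2T−τ−α) − p̃(τ−α)) g(α) dα`. -/
theorem stmt11 (T : ℝ) (hT : 0 < T) (r g : ℝ → ℝ)
    (hr : ContinuousOn r (Icc 0 (2 * T)))
    (hg : ContinuousOn g (Icc 0 (2 * T)))
    (hgeven : ∀ s ∈ Icc (0:ℝ) (2 * T), g (2 * T - s) = g s)
    (p ptilde : ℝ → ℝ)
    (hp : ∀ s : ℝ, p s = ∫ α in (0:ℝ)..s, r α)
    (hptilde : ∀ s : ℝ, ptilde s = if 0 ≤ s then p s else -p (-s)) :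
    ∀ τ ∈ Icc (0:ℝ) T,
      (∫ σ in τ..(2 * T - τ), ∫ s in (0:ℝ)..σ, r s * g (σ - s))
        = ∫ α in (0:ℝ)..T, (ptilde (2 * T - τ - α) - ptilde (τ - α)) * g α := by
  intro τ hτ
  have h2T : (0:ℝ) ≤ 2 * T := by linarith
  set r' : ℝ → ℝ := IccExtend h2T ((Icc 0 (2 * T)).domRestrict r)
  set g' : ℝ → ℝ := IccExtend h2T ((Icc 0 (2 * T)).domRestrict g)
  have hr' : Continuous r' := hr.domRestrict.Icc_extend'
  have hg' : Continuous g' := hg.domRestrict.Icc_extend'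
  have hrr {s : ℝ} (hs : s ∈ Icc (0:ℝ) (2 * T)) : r' s = r s := IccExtend_of_mem h2T _ hs
  have hgg {s : ℝ} (hs : s ∈ Icc (0:ℝ) (2 * T)) : g' s = g s := IccExtend_of_mem h2T _ hs
  set P : ℝ → ℝ := fun s => ∫ α in (0:ℝ)..s, r' α with hP
  have hPp {s : ℝ} (hs : s ∈ Icc (0:ℝ) (2 * T)) : P s = p s := by
    rw [hp]
    refine integral_congr fun α hα => hrr ?_
    rw [uIcc_of_le hs.1] at hα
    exact ⟨hα.1, hα.2.trans hs.2⟩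
  have key := integral_convolution_eq_of_even (T := T) (τ := τ)
    (q := fun s => if 0 ≤ s then P s else -P (-s)) hr' hg'
    (fun s hs => by
      rw [hgg hs, hgg ⟨by linarith [hs.2], by linarith [hs.1]⟩, hgeven s hs])
    (fun s hs => if_pos hs)
    (fun s hs => by
      rcases hs.eq_or_lt with rfl | hs
      · simp [hP]
      · exact if_neg hs.not_ge) hτ
  have hqt {s : ℝ} (hs : s ∈ Icc (-(2 * T)) (2 * T)) :
      (if 0 ≤ s then P s else -P (-s)) = ptilde s := by
    rw [hptilde]
    split_ifs with h
    · exact hPp ⟨h, hs.2⟩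
    · rw [hPp ⟨by linarith, by linarith [hs.1]⟩]
  obtain ⟨hτ0, hτT⟩ := hτ
  convert key using 1
  · refine integral_congr fun σ hσ => integral_congr fun s hs => ?_
    rw [uIcc_of_le (by linarith)] at hσ
    rw [uIcc_of_le (hτ0.trans hσ.1)] at hs
    have hσ2 : σ ≤ 2 * T := by linarith [hσ.2]
    simp only [hrr ⟨hs.1, hs.2.trans hσ2⟩, hgg ⟨sub_nonneg.2 hs.2, by linarith [hs.1]⟩]
  · refine integral_congr fun α hα => ?_
    rw [uIcc_of_le hT.le] at hα
    obtain ⟨hα0, hαT⟩ := hα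
    simp only [hqt (s := 2 * T - τ - α) ⟨by linarith, by linarith⟩,
      hqt (s := τ - α) ⟨by linarith, by linarith⟩, hgg ⟨hα0, show α ≤ 2 * T by linarith⟩]
end

section
/- Let T > 0, let r : [0,2T] → ℝ be continuous, and let g : [0,2T] → ℝ be continuous with g(2T−s) = g(s) for all s ∈ [0,2T] (even with respect to s = T). Then for every τ ∈ [0,T]: ∫_0^τ r(s) g(τ−s) ds + ∫_0^{2T−τ} r(s) g(2T−τ−s) ds = ∫_0^T ( r(|τ−α|) + r(2T−τ−α) ) g(α) dα. -/
open Set intervalIntegral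

/-- Commutativity of the convolution on `[0, t]`. -/
theorem integral_mul_comp_sub (r g : ℝ → ℝ) (t : ℝ) :
    ∫ s in (0:ℝ)..t, r s * g (t - s) = ∫ α in (0:ℝ)..t, r (t - α) * g α := by
  simpa using integral_comp_sub_left (a := 0) (b := t) (fun α => r (t - α) * g α) t

/-- The `(2,2)`-entry of the connecting-operator kernel: for continuous
`r : [0,2T] → ℝ` and continuous `g` even with respect to `s = T`, one has for
every `τ ∈ [0,T]`:
`∫_0^τ r(s)g(τ−s) ds + ∫_0^{2T−τ} r(s)g(2T−τ−s) ds
  = ∫_0^T (r(|τ−α|) + r(2T−τ−α)) g(α) dα`. -/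
theorem stmt12 (T : ℝ) (hT : 0 < T) (r g : ℝ → ℝ)
    (hr : ContinuousOn r (Icc 0 (2 * T)))
    (hg : ContinuousOn g (Icc 0 (2 * T)))
    (hgeven : ∀ s ∈ Icc (0:ℝ) (2 * T), g (2 * T - s) = g s) :
    ∀ τ ∈ Icc (0:ℝ) T,
      ((∫ s in (0:ℝ)..τ, r s * g (τ - s))
        + ∫ s in (0:ℝ)..(2 * T - τ), r s * g (2 * T - τ - s))
      = ∫ α in (0:ℝ)..T, (r |τ - α| + r (2 * T - τ - α)) * g α := by
  rintro τ ⟨h0, hτT⟩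
  have habs : ContinuousOn (fun α => r |τ - α| * g α) (Icc 0 T) := by
    refine (hr.comp (by fun_prop) fun α hα => ?_).mul
      (hg.mono (Icc_subset_Icc_right (by linarith)))
    exact ⟨abs_nonneg _, abs_le.2 ⟨by linarith [hα.2], by linarith [hα.1]⟩⟩
  have hsub : ContinuousOn (fun α => r (2 * T - τ - α) * g α) (Icc 0 (2 * T - τ)) := by
    refine (hr.comp (by fun_prop) fun α hα => ?_).mul
      (hg.mono (Icc_subset_Icc_right (by linarith)))
    exact ⟨by linarith [hα.2], by linarith [hα.1]⟩
  have iabs {a b : ℝ} (ha : 0 ≤ a) (hab : a ≤ b) (hb : b ≤ T) :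
      IntervalIntegrable (fun α => r |τ - α| * g α) MeasureTheory.volume a b :=
    (habs.mono (Icc_subset_Icc ha hb)).intervalIntegrable_of_Icc hab
  have isub {a b : ℝ} (ha : 0 ≤ a) (hab : a ≤ b) (hb : b ≤ 2 * T - τ) :
      IntervalIntegrable (fun α => r (2 * T - τ - α) * g α) MeasureTheory.volume a b :=
    (hsub.mono (Icc_subset_Icc ha hb)).intervalIntegrable_of_Icc hab
  have hleft : ∫ α in (0:ℝ)..τ, r (τ - α) * g α = ∫ α in (0:ℝ)..τ, r |τ - α| * g α := by
    refine integral_congr fun α hα => ?_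
    rw [uIcc_of_le h0] at hα
    simp only [abs_of_nonneg (sub_nonneg.2 hα.2)]
  have hright : ∫ α in T..(2 * T - τ), r (2 * T - τ - α) * g α
      = ∫ α in τ..T, r |τ - α| * g α := by
    have hreflect := integral_comp_sub_left (a := τ) (b := T)
      (fun α => r (2 * T - τ - α) * g α) (2 * T)
    rw [show 2 * T - T = T by ring] at hreflect
    rw [← hreflect]
    refine integral_congr fun α hα => ?_
    rw [uIcc_of_le hτT] at hα
    have hα' : α ∈ Icc (0:ℝ) (2 * T) := ⟨h0.trans hα.1, by linarith [hα.2]⟩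
    simp only [hgeven α hα', abs_of_nonpos (sub_nonpos.2 hα.1)]
    congr 2
    ring
  simp only [add_mul]
  rw [integral_mul_comp_sub, integral_mul_comp_sub,
    integral_add (iabs le_rfl hT.le le_rfl) (isub le_rfl hT.le (by linarith)),
    ← integral_add_adjacent_intervals (isub le_rfl hT.le (by linarith))
      (isub hT.le (by linarith) le_rfl),
    ← integral_add_adjacent_intervals (iabs le_rfl h0 hτT) (iabs h0 hτT le_rfl),
    hleft, hright]
  ring
end

section
/- Let T > 0, let r : [0,2T] → ℝ be continuous, and let g : [0,2T] → ℝ be continuous with g(2T−s) = −g(s) for all s ∈ [0,2T] (odd with respect to s = T). Let r̃ : ℝ → ℝ be the odd extension r̃(s) = r(s) for s ≥ 0, r̃(s) = −r(−s) for s < 0. Then for every τ ∈ [0,T]: ∫_0^τ r(s) g(τ−s) ds + ∫_0^{2T−τ} r(s) g(2T−τ−s) ds = ∫_0^T ( r̃(τ−α) + r̃(2T−τ−α) ) g(α) dα. -/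
open Set intervalIntegral

theorem integral_congr_uIoc {a b : ℝ} {f g : ℝ → ℝ} (h : EqOn f g (uIoc a b)) :
    ∫ x in a..b, f x = ∫ x in a..b, g x :=
  integral_congr_ae (.of_forall fun _ hx => h hx)

/-- The `(2,1)`-entry of the connecting-operator kernel: for continuous
`r : [0,2T] → ℝ` and continuous `g` odd with respect to `s = T`, with `r̃` the
odd extension of `r`, one has for every `τ ∈ [0,T]`:
`∫_0^τ r(s)g(τ−s) ds + ∫_0^{2T−τ} r(s)g(2T−τ−s) ds
  = ∫_0^T (r̃(τ−α) + r̃(2T−τ−α)) g(α) dα`. -/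
theorem stmt13 (T : ℝ) (hT : 0 < T) (r g : ℝ → ℝ)
    (hr : ContinuousOn r (Icc 0 (2 * T)))
    (hg : ContinuousOn g (Icc 0 (2 * T)))
    (hgodd : ∀ s ∈ Icc (0:ℝ) (2 * T), g (2 * T - s) = -g s)
    (rtilde : ℝ → ℝ)
    (hrtilde : ∀ s : ℝ, rtilde s = if 0 ≤ s then r s else -r (-s)) :
    ∀ τ ∈ Icc (0:ℝ) T,
      ((∫ s in (0:ℝ)..τ, r s * g (τ - s))
        + ∫ s in (0:ℝ)..(2 * T - τ), r s * g (2 * T - τ - s))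
      = ∫ α in (0:ℝ)..T, (rtilde (τ - α) + rtilde (2 * T - τ - α)) * g α := by
  rintro τ ⟨h0, h1⟩
  have cont_left : ContinuousOn (fun α => r (τ - α) * g α) (uIcc 0 τ) := by
    rw [uIcc_of_le h0]
    refine (hr.comp (by fun_prop) ?_).mul (hg.mono ?_)
    · rintro x ⟨hx0, hx1⟩
      constructor <;> linarith
    · rintro x ⟨hx0, hx1⟩
      constructor <;> linarith
  have cont_right : ContinuousOn (fun α => -r (α - τ) * g α) (uIcc τ T) := by
    rw [uIcc_of_le h1]
    refine (hr.comp (by fun_prop) ?_).neg.mul (hg.mono ?_)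
    · rintro x ⟨hx0, hx1⟩
      constructor <;> linarith
    · rintro x ⟨hx0, hx1⟩
      constructor <;> linarith
  have cont_long : ContinuousOn (fun α => r (2 * T - τ - α) * g α) (Icc 0 (2 * T - τ)) := by
    refine (hr.comp (by fun_prop) ?_).mul (hg.mono ?_)
    · rintro x ⟨hx0, hx1⟩
      constructor <;> linarith
    · rintro x ⟨hx0, hx1⟩
      constructor <;> linarith
  have int_long_left : IntervalIntegrable (fun α => r (2 * T - τ - α) * g α)
      MeasureTheory.volume 0 T := by
    refine (cont_long.mono ?_).intervalIntegrable
    rw [uIcc_of_le hT.le]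
    exact Icc_subset_Icc_right (by linarith)
  have int_long_right : IntervalIntegrable (fun α => r (2 * T - τ - α) * g α)
      MeasureTheory.volume T (2 * T - τ) := by
    refine (cont_long.mono ?_).intervalIntegrable
    rw [uIcc_of_le (by linarith)]
    exact Icc_subset_Icc_left hT.le
  have eq_left : EqOn (fun α => r (τ - α) * g α) (fun α => rtilde (τ - α) * g α)
      (uIoc 0 τ) := by
    rw [uIoc_of_le h0]
    rintro x ⟨_, hx⟩
    simp only [hrtilde, if_pos (sub_nonneg.2 hx)]
  have eq_right : EqOn (fun α => -r (α - τ) * g α) (fun α => rtilde (τ - α) * g α)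
      (uIoc τ T) := by
    rw [uIoc_of_le h1]
    rintro x ⟨hx, _⟩
    simp only [hrtilde, if_neg (not_le.2 (sub_neg.2 hx)), neg_sub]
  have eq_long : EqOn (fun α => r (2 * T - τ - α) * g α)
      (fun α => rtilde (2 * T - τ - α) * g α) (uIoc 0 T) := by
    rw [uIoc_of_le hT.le]
    rintro x ⟨_, hx⟩
    simp only [hrtilde, if_pos (show 0 ≤ 2 * T - τ - x by linarith)]
  have int_left := cont_left.intervalIntegrable (μ := MeasureTheory.volume) |>.congr eq_left
  have int_right := cont_right.intervalIntegrable (μ := MeasureTheory.volume) |>.congr eq_right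
  have first : (∫ s in (0:ℝ)..τ, r s * g (τ - s)) = ∫ α in (0:ℝ)..τ, rtilde (τ - α) * g α := by
    have h := integral_comp_sub_left (a := 0) (b := τ) (fun s => r s * g (τ - s)) τ
    simp only [sub_self, sub_zero, sub_sub_cancel] at h
    rw [← h]
    exact integral_congr_uIoc eq_left
  have second : (∫ s in (0:ℝ)..(2 * T - τ), r s * g (2 * T - τ - s))
      = ∫ α in (0:ℝ)..(2 * T - τ), r (2 * T - τ - α) * g α := by
    have h := integral_comp_sub_left (a := 0) (b := 2 * T - τ)
      (fun s => r s * g (2 * T - τ - s)) (2 * T - τ)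
    simp only [sub_self, sub_zero, sub_sub_cancel] at h
    exact h.symm
  have reflected : (∫ α in T..(2 * T - τ), r (2 * T - τ - α) * g α)
      = ∫ α in τ..T, rtilde (τ - α) * g α := by
    have h := integral_comp_sub_left (a := τ) (b := T)
      (fun α => r (2 * T - τ - α) * g α) (2 * T)
    rw [show 2 * T - T = T by ring] at h
    rw [← h, ← integral_congr_uIoc eq_right]
    refine integral_congr fun x hx => ?_
    rw [uIcc_of_le h1] at hx
    obtain ⟨hx0, hx1⟩ := hx
    simp only [hgodd x ⟨by linarith, by linarith⟩]
    rw [show 2 * T - τ - (2 * T - x) = x - τ by ring]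
    ring
  simp only [add_mul]
  rw [integral_add (int_left.trans int_right) (int_long_left.congr eq_long),
    ← integral_congr_uIoc eq_long, ← integral_add_adjacent_intervals int_left int_right,
    first, second, ← integral_add_adjacent_intervals int_long_left int_long_right, reflected]
  ring
end

section
/- Let T > 0 and let a, b : ℝ → ℝ be continuous odd functions such that for all t, s ∈ (0,T): −a(t−s) − a(2T−t−s) = b(2T−t−s) − b(s−t). Then a(σ) = −b(σ) for all σ ∈ (−2T, 2T). -/
open Set

/-- Consequence of the symmetry of the connecting operator: if `a`, `b` are
continuous odd functions with `−a(t−s) − a(2T−t−s) = b(2T−t−s) − b(s−t)` for all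
`t, s ∈ (0,T)`, then `a = −b` on `(−2T, 2T)`. -/
theorem stmt14 (T : ℝ) (hT : 0 < T) (a b : ℝ → ℝ)
    (ha : Continuous a) (hb : Continuous b)
    (haodd : ∀ x : ℝ, a (-x) = -a x) (hbodd : ∀ x : ℝ, b (-x) = -b x)
    (h : ∀ t ∈ Ioo (0:ℝ) T, ∀ s ∈ Ioo (0:ℝ) T,
      -a (t - s) - a (2 * T - t - s) = b (2 * T - t - s) - b (s - t)) :
    ∀ σ ∈ Ioo (-(2 * T)) (2 * T), a σ = -b σ := by
  have ha0 : a 0 = 0 := by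
    have := haodd 0
    rw [neg_zero] at this
    linarith
  have hb0 : b 0 = 0 := by
    have := hbodd 0
    rw [neg_zero] at this
    linarith
  have hpos : ∀ σ ∈ Ioo 0 (2 * T), a σ = -b σ := by
    rintro σ ⟨h₁, h₂⟩
    have ht : T - σ / 2 ∈ Ioo 0 T := ⟨by linarith, by linarith⟩
    have hdiag := h _ ht _ ht
    rw [sub_self, show 2 * T - (T - σ / 2) - (T - σ / 2) = σ by ring, ha0, hb0] at hdiag
    linarith
  rintro σ ⟨h₁, h₂⟩
  rcases lt_trichotomy σ 0 with hσ | rfl | hσ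
  · have hneg := hpos (-σ) ⟨by linarith, by linarith⟩
    rw [haodd, hbodd] at hneg
    linarith
  · rw [ha0, hb0, neg_zero]
  · exact hpos σ ⟨hσ, h₂⟩
end

section
/- Let T > 0. Let C̃ : [0,T] × [0,T] → Matrix (Fin 2) (Fin 2) ℝ be continuous, and let m : [0,T] × [0,T] → Matrix (Fin 2) (Fin 2) ℝ be continuous with m(x,s) = 0 whenever s < x. Define Φ(x,s) = m(x,s) + C̃(x,s) + ∫_0^T C̃(x,α) m(α,s) dα, and suppose that for all x, s ∈ [0,T]: (m(s,x))ᵀ + Φ(x,s) + ∫_0^x (m(α,x))ᵀ Φ(α,s) dα = 0. Then the Gelfand–Levitan equation holds: m(x,s) + C̃(x,s) + ∫_0^T C̃(x,α) m(α,s) dα = 0 for all 0 ≤ x < s ≤ T. -/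
open Set intervalIntegral Matrix

/-- A matrix-valued function that is continuous on a compact set has uniformly bounded entries. -/
lemma exists_entry_bound {X n : Type*} [TopologicalSpace X] [Fintype n]
    {S : Set X} (hS : IsCompact S) {A : X → Matrix n n ℝ} (hA : ContinuousOn A S) :
    ∃ c : ℝ, 0 ≤ c ∧ ∀ p ∈ S, ∀ i j, |A p i j| ≤ c := by
  have h : ∀ q : n × n, ∃ c, ∀ p ∈ S, ‖A p q.1 q.2‖ ≤ c := fun q =>
    hS.exists_bound_of_continuousOn
      ((continuous_id.matrix_elem q.1 q.2).comp_continuousOn hA)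
  choose c hc using h
  refine ⟨∑ q, |c q|, Finset.sum_nonneg fun _ _ => abs_nonneg _, fun p hp i j => ?_⟩
  calc |A p i j| ≤ |c (i, j)| := (hc (i, j) p hp).trans (le_abs_self _)
    _ ≤ ∑ q, |c q| :=
      Finset.single_le_sum (f := fun q => |c q|) (fun _ _ => abs_nonneg _) (Finset.mem_univ _)

lemma abs_mul_entry_le {n : Type*} [Fintype n] {A B : Matrix n n ℝ} {a b : ℝ} (ha : 0 ≤ a)
    (hA : ∀ i j, |A i j| ≤ a) (hB : ∀ i j, |B i j| ≤ b) (i j : n) :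
    |(A * B) i j| ≤ Fintype.card n * (a * b) := by
  rw [Matrix.mul_apply]
  calc |∑ k, A i k * B k j| ≤ ∑ k, |A i k * B k j| := Finset.abs_sum_le_sum_abs _ _
    _ ≤ ∑ _k : n, a * b := Finset.sum_le_sum fun k _ => by
      rw [abs_mul]
      exact mul_le_mul (hA i k) (hB k j) (abs_nonneg _) ha
    _ = Fintype.card n * (a * b) := by simp

/-- A bounded solution of a homogeneous Volterra equation of the second kind with bounded
matrix kernel vanishes. -/
lemma volterra_eq_zero {n : Type*} [Fintype n] {s a b : ℝ} (ha : 0 ≤ a)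
    {K : ℝ → ℝ → Matrix n n ℝ} {F : ℝ → Matrix n n ℝ}
    (hK : ∀ x ∈ Ico 0 s, ∀ α ∈ Ico 0 s, ∀ i j, |K x α i j| ≤ a)
    (hF : ∀ x ∈ Ico 0 s, ∀ i j, |F x i j| ≤ b)
    (h : ∀ x ∈ Ico 0 s, ∀ i j, F x i j + ∫ α in (0:ℝ)..x, (K x α * F α) i j = 0) :
    ∀ x ∈ Ico 0 s, ∀ i j, F x i j = 0 := by
  set L : ℝ := Fintype.card n * a with hL
  have key : ∀ k : ℕ, ∀ x ∈ Ico 0 s, ∀ i j,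
      |F x i j| ≤ b * ((L * x) ^ k / k.factorial) := by
    intro k
    induction k with
    | zero => simpa using hF
    | succ k ih =>
      intro x hx i j
      rw [eq_neg_of_add_eq_zero_left (h x hx i j), abs_neg]
      have hint : ∫ α in (0:ℝ)..x, L * (b * ((L * α) ^ k / k.factorial))
          = b * ((L * x) ^ (k + 1) / (k + 1).factorial) := by
        have e : ∀ α : ℝ, L * (b * ((L * α) ^ k / k.factorial))
            = L ^ (k + 1) * b / k.factorial * α ^ k := fun α => by ring
        simp_rw [e]
        rw [intervalIntegral.integral_const_mul, integral_pow, Nat.factorial_succ]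
        push_cast
        have : (k.factorial : ℝ) ≠ 0 := by positivity
        have : (k : ℝ) + 1 ≠ 0 := by positivity
        field_simp
        simp
        ring
      rw [← hint, ← Real.norm_eq_abs]
      refine norm_integral_le_of_norm_le hx.1 (.of_forall fun α hα => ?_)
        (Continuous.intervalIntegrable (by fun_prop) _ _)
      have hα' : α ∈ Ico 0 s := ⟨hα.1.le, hα.2.trans_lt hx.2⟩
      refine (abs_mul_entry_le ha (hK x hx α hα') (ih α hα') i j).trans_eq ?_
      rw [hL]; ring
  intro x hx i j
  have lim := (FloorSemiring.tendsto_pow_div_factorial_atTop (L * x)).const_mul b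
  rw [mul_zero] at lim
  exact abs_nonpos_iff.mp (ge_of_tendsto' lim fun k => key k x hx i j)

/-- Derivation of the Gelfand–Levitan equation: if `m` is the (upper-triangular,
i.e. `m(x,s) = 0` for `s < x`) matrix kernel, `C̃` the reflected connecting
kernel, `Φ(x,s) = m(x,s) + C̃(x,s) + ∫_0^T C̃(x,α) m(α,s) dα`, and the kernel
form `(m(s,x))ᵀ + Φ(x,s) + ∫_0^x (m(α,x))ᵀ Φ(α,s) dα = 0` of the operator
identity holds, then `m(x,s) + C̃(x,s) + ∫_0^T C̃(x,α) m(α,s) dα = 0` for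
`0 ≤ x < s ≤ T`.  (All matrix-valued integrals are taken entrywise.) -/
theorem stmt17 (T : ℝ) (hT : 0 < T)
    (Ctilde m : ℝ → ℝ → Matrix (Fin 2) (Fin 2) ℝ)
    (hC : ContinuousOn (Function.uncurry Ctilde) (Icc 0 T ×ˢ Icc 0 T))
    (hm : ContinuousOn (Function.uncurry m) (Icc 0 T ×ˢ Icc 0 T))
    (hmtri : ∀ x ∈ Icc (0:ℝ) T, ∀ s ∈ Icc (0:ℝ) T, s < x → m x s = 0)
    (Φ : ℝ → ℝ → Matrix (Fin 2) (Fin 2) ℝ)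
    (hΦ : ∀ x s : ℝ, ∀ i j : Fin 2,
      Φ x s i j = m x s i j + Ctilde x s i j
        + ∫ α in (0:ℝ)..T, (Ctilde x α * m α s) i j)
    (hker : ∀ x ∈ Icc (0:ℝ) T, ∀ s ∈ Icc (0:ℝ) T, ∀ i j : Fin 2,
      (m s x)ᵀ i j + Φ x s i j
        + (∫ α in (0:ℝ)..x, ((m α x)ᵀ * Φ α s) i j) = 0) :
    ∀ x s : ℝ, 0 ≤ x → x < s → s ≤ T → ∀ i j : Fin 2,
      m x s i j + Ctilde x s i j
        + ∫ α in (0:ℝ)..T, (Ctilde x α * m α s) i j = 0 := by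
  obtain ⟨c, hc0, hc⟩ := exists_entry_bound (isCompact_Icc.prod isCompact_Icc) hC
  obtain ⟨a, ha0, ha⟩ := exists_entry_bound (isCompact_Icc.prod isCompact_Icc) hm
  intro x s hx hxs hsT i j
  have hs : s ∈ Icc 0 T := ⟨hx.trans hxs.le, hsT⟩
  have mem : ∀ y ∈ Ico 0 s, y ∈ Icc 0 T := fun y hy => ⟨hy.1, hy.2.le.trans hsT⟩
  rw [← hΦ]
  refine volterra_eq_zero (K := fun y α => (m α y)ᵀ) (F := fun y => Φ y s) (s := s)
    (b := a + c + 2 * (c * a) * T) ha0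
    (fun y hy α hα i j => ha (α, y) ⟨mem α hα, mem y hy⟩ j i) (fun y hy i j => ?_)
    (fun y hy i j => ?_) x ⟨hx, hxs⟩ i j
  · have hI : ‖∫ α in (0:ℝ)..T, (Ctilde y α * m α s) i j‖ ≤ 2 * (c * a) * |T - 0| := by
      refine norm_integral_le_of_norm_le_const fun α hα => ?_
      rw [uIoc_of_le hT.le] at hα
      have hα' : α ∈ Icc 0 T := ⟨hα.1.le, hα.2⟩
      simpa using abs_mul_entry_le hc0 (hc (y, α) ⟨mem y hy, hα'⟩) (ha (α, s) ⟨hα', hs⟩) i j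
    rw [sub_zero, abs_of_pos hT, Real.norm_eq_abs] at hI
    simp only [hΦ]
    exact (abs_add_three _ _ _).trans
      (add_le_add_three (ha (y, s) ⟨mem y hy, hs⟩ i j) (hc (y, s) ⟨mem y hy, hs⟩ i j) hI)
  · simpa [hmtri s hs y (mem y hy) hy.2] using hker y (mem y hy) s hs i j
end

section
/- Let T > 0, let q : [−T,T] → ℝ be continuous, and let y : [−T,T] → ℝ be twice continuously differentiable with −y''(x) + q(x)y(x) = 0 for all x ∈ (−T,T), y(0) = 0 and y'(0) = 1. Let g₁, g₂ : ℝ → ℝ be smooth functions vanishing outside a compact subset of (0,T). Let v : ℝ × [0,T] → ℝ be twice continuously differentiable on each of {x ≥ 0} × [0,T] and {x ≤ 0} × [0,T] (with one-sided limits at x = 0), satisfying: v_tt(x,t) − v_xx(x,t) + q(x)v(x,t) = 0 for x ≠ 0; there is δ > 0 with v(x,t) = 0 whenever |x| ≥ t − δ; v(x,0) = v_t(x,0) = 0 for all x; and the jump conditions v(0⁺,t) − v(0⁻,t) = g₁(t), v_x(0⁺,t) − v_x(0⁻,t) = g₂'(t) for all t ∈ (0,T). Then ∫_{−T}^T y(x)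 v(x,T) dx = ∫_0^T (T−t) g₁(t) dt. -/
open Set Filter Topology intervalIntegral

/-- Taylor's formula of order two with integral remainder, for zero Cauchy data at the origin. -/
lemma integral_sub_mul_deriv_deriv {f : ℝ → ℝ} (hf : ContDiff ℝ 2 f) (h0 : f 0 = 0)
    (h1 : deriv f 0 = 0) (T : ℝ) :
    ∫ t in (0:ℝ)..T, (T - t) * deriv (deriv f) t = f T := by
  have hd : Differentiable ℝ f := hf.differentiable (by norm_num)
  have hdd : Differentiable ℝ (deriv f) := hf.differentiable_deriv_two
  have hc : Continuous (deriv (deriv f)) := by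
    simpa using hf.continuous_iteratedDeriv 2 le_rfl |>.congr fun x => by
      rw [iteratedDeriv_succ, iteratedDeriv_one]
  have key : ∀ t ∈ uIcc 0 T,
      HasDerivAt (fun t => (T - t) * deriv f t + f t) ((T - t) * deriv (deriv f) t) t := by
    intro t _
    have := (((hasDerivAt_id t).const_sub T).mul (hdd t).hasDerivAt).add (hd t).hasDerivAt
    exact this.congr_deriv (by simp)
  rw [integral_eq_sub_of_hasDerivAt key
    (Continuous.intervalIntegrable (by fun_prop) _ _)]
  simp [h0, h1]

/-- A partial derivative of a `C^{n+1}` function of two variables is jointly `C^n`. -/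
lemma ContDiff.uncurry_deriv_snd {v : ℝ → ℝ → ℝ} {m n : WithTop ℕ∞}
    (hv : ContDiff ℝ n (Function.uncurry v)) (hmn : m + 1 ≤ n) :
    ContDiff ℝ m (Function.uncurry fun x t => deriv (v x) t) := by
  have hd : Differentiable ℝ (Function.uncurry v) :=
    hv.differentiable (by rintro rfl; simp at hmn)
  have h : (Function.uncurry fun x t => deriv (v x) t) =
      fun p => fderiv ℝ (Function.uncurry v) p (0, 1) := by
    ext ⟨x, t⟩
    have hp : HasDerivAt (fun t : ℝ => (x, t)) (0, 1) t :=
      (hasDerivAt_const t x).prodMk (hasDerivAt_id t)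
    exact ((hd (x, t)).hasFDerivAt.comp_hasDerivAt t hp).deriv
  rw [h]
  exact (hv.fderiv_right hmn).clm_apply contDiff_const

/-- Green's formula on `[0, S]` for a function `w` vanishing near `S` and the solution `y` of
`y'' = q y`, `y(0) = 0`, `y'(0) = 1`. -/
lemma integral_mul_eq_of_green {S : ℝ} (hS : 0 < S) {q y w f : ℝ → ℝ}
    (hyc : ContinuousOn y (Icc 0 S)) (hy'c : ContinuousOn (deriv y) (Icc 0 S))
    (hyd : ∀ x ∈ Ioo 0 S, DifferentiableAt ℝ y x)
    (hy'd : ∀ x ∈ Ioo 0 S, DifferentiableAt ℝ (deriv y) x)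
    (hyeq : ∀ x ∈ Ioo 0 S, -(deriv (deriv y) x) + q x * y x = 0)
    (hy0 : y 0 = 0) (hy'0 : deriv y 0 = 1)
    (hw : ContDiff ℝ 2 w) (hf : Continuous f)
    (hweq : ∀ x, 0 < x → f x - deriv (deriv w) x + q x * w x = 0)
    (hwS : ∀ᶠ x in 𝓝 S, w x = 0) :
    ∫ x in (0:ℝ)..S, y x * f x = w 0 := by
  have hd : Differentiable ℝ w := hw.differentiable (by norm_num)
  have hdd : Differentiable ℝ (deriv w) := hw.differentiable_deriv_two
  have hw0 : w S = 0 := hwS.self_of_nhds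
  have hw1 : deriv w S = 0 := by
    have h : w =ᶠ[𝓝 S] fun _ => 0 := hwS
    simpa using h.deriv_eq
  have hwc : ContinuousOn w (Icc 0 S) := hd.continuous.continuousOn
  have hw'c : ContinuousOn (deriv w) (Icc 0 S) := hdd.continuous.continuousOn
  have key : ∀ x ∈ Ioo 0 S,
      HasDerivAt (fun x => y x * deriv w x - deriv y x * w x) (y x * f x) x := by
    intro x hx
    have := ((hyd x hx).hasDerivAt.mul (hdd x).hasDerivAt).sub
      ((hy'd x hx).hasDerivAt.mul (hd x).hasDerivAt)
    refine this.congr_deriv ?_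
    linear_combination w x * hyeq x hx - y x * hweq x hx.1
  rw [integral_eq_sub_of_hasDerivAt_of_le hS.le
    ((hyc.mul hw'c).sub (hy'c.mul hwc)) key
    ((hyc.mul hf.continuousOn).intervalIntegrable_of_Icc hS.le)]
  simp [hw0, hw1, hy0, hy'0]

/-- The pairing of the solution `y` of `y'' = q y`, `y(0) = 0`, `y'(0) = 1` with a wave on the
half-line depends only on the boundary trace of the wave. -/
lemma integral_mul_wave_halfline {T : ℝ} (hT : 0 < T) {q y : ℝ → ℝ}
    (hy : ContDiffOn ℝ 2 y (Icc (-T) T))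
    (hyeq : ∀ x ∈ Ioo (-T) T, -(deriv (deriv y) x) + q x * y x = 0)
    (hy0 : y 0 = 0) (hy'0 : deriv y 0 = 1)
    {v : ℝ → ℝ → ℝ} (hv : ContDiff ℝ 2 (Function.uncurry v))
    (hweq : ∀ x : ℝ, 0 < x → ∀ t ∈ Icc (0:ℝ) T,
      deriv (deriv (v x)) t
        - deriv (fun ξ => deriv (fun ζ => v ζ t) ξ) x + q x * v x t = 0)
    {δ : ℝ} (hδ : 0 < δ) (hfront : ∀ x t : ℝ, t - δ ≤ |x| → v x t = 0)
    (hinit : ∀ x : ℝ, v x 0 = 0 ∧ deriv (v x) 0 = 0) :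
    ∫ x in (0:ℝ)..T, y x * v x T = ∫ t in (0:ℝ)..T, (T - t) * v 0 t := by
  obtain ⟨S, hS, hST⟩ := exists_between (max_lt hT (sub_lt_self T hδ))
  obtain ⟨hS0, hSδ⟩ := max_lt_iff.1 hS
  have hy2 : ContDiffOn ℝ 2 y (Ioo (-T) T) := hy.mono Ioo_subset_Icc_self
  have hy1 : ContDiffOn ℝ 1 (deriv y) (Ioo (-T) T) :=
    hy2.deriv_of_isOpen isOpen_Ioo (by norm_num)
  have hsub : Icc 0 S ⊆ Ioo (-T) T := fun x hx => ⟨by linarith [hx.1], by linarith [hx.2]⟩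
  have hsub' : Ioo 0 S ⊆ Ioo (-T) T := Ioo_subset_Icc_self.trans hsub
  have hyc : ContinuousOn y (Icc 0 S) := hy2.continuousOn.mono hsub
  have hvtt : Continuous (Function.uncurry fun x t => deriv (deriv (v x)) t) :=
    ((hv.uncurry_deriv_snd (m := 1) (by norm_num)).uncurry_deriv_snd
      (m := 0) (by norm_num)).continuous
  have hvx : ∀ x, ContDiff ℝ 2 (v x) := fun x =>
    hv.comp (contDiff_const.prodMk contDiff_id : ContDiff ℝ 2 fun t : ℝ => (x, t))
  have hvt : ∀ t, ContDiff ℝ 2 (fun x => v x t) := fun t =>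
    hv.comp (contDiff_id.prodMk contDiff_const : ContDiff ℝ 2 fun x : ℝ => (x, t))
  have htail : ∫ x in (0:ℝ)..T, y x * v x T = ∫ x in (0:ℝ)..S, y x * v x T := by
    have hzero : EqOn (fun x => y x * v x T) (fun _ => 0) (uIcc S T) := by
      intro x hx
      rw [uIcc_of_le hST.le] at hx
      have := hfront x T (by linarith [le_abs_self x, hx.1])
      simp [this]
    have hc : ContinuousOn (fun x => y x * v x T) (Icc 0 T) :=
      (hy.continuousOn.mono (Icc_subset_Icc_left (by linarith))).mul
        (hvt T).continuous.continuousOn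
    have hi := hc.intervalIntegrable_of_Icc (μ := MeasureTheory.volume) hT.le
    have h0 : ∫ x in S..T, y x * v x T = 0 := by
      rw [integral_congr hzero]; simp
    rw [← integral_add_adjacent_intervals (b := S), h0, add_zero]
    · exact (hc.mono (Icc_subset_Icc_right hST.le)).intervalIntegrable_of_Icc hS0.le
    · exact (hc.mono (Icc_subset_Icc_left hS0.le)).intervalIntegrable_of_Icc hST.le
  calc ∫ x in (0:ℝ)..T, y x * v x T
      = ∫ x in (0:ℝ)..S, y x * v x T := htail
    _ = ∫ x in (0:ℝ)..S, ∫ t in (0:ℝ)..T, y x * ((T - t) * deriv (deriv (v x)) t) := by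
        refine integral_congr fun x _ => ?_
        rw [integral_const_mul,
          integral_sub_mul_deriv_deriv (hvx x) (hinit x).1 (hinit x).2 T]
    _ = ∫ t in (0:ℝ)..T, ∫ x in (0:ℝ)..S, y x * ((T - t) * deriv (deriv (v x)) t) := by
        refine MeasureTheory.intervalIntegral_intervalIntegral_swap ?_
        rw [uIoc_of_le hS0.le, uIoc_of_le hT.le]
        refine MeasureTheory.IntegrableOn.mono_set (t := Icc 0 S ×ˢ Icc 0 T) ?_
          (prod_mono Ioc_subset_Icc_self Ioc_subset_Icc_self)
        refine ContinuousOn.integrableOn_compact (isCompact_Icc.prod isCompact_Icc) ?_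
        refine (hyc.comp continuousOn_fst fun p hp => hp.1).mul (Continuous.continuousOn ?_)
        exact (continuous_const.sub continuous_snd).mul hvtt
    _ = ∫ t in (0:ℝ)..T, (T - t) * v 0 t := by
        refine integral_congr fun t ht => ?_
        rw [uIcc_of_le hT.le] at ht
        simp only [mul_left_comm (y _)]
        rw [integral_const_mul]
        congr 1
        refine integral_mul_eq_of_green (q := q) hS0 hyc (hy1.continuousOn.mono hsub)
          (fun x hx => (hy2.differentiableOn (by norm_num)).differentiableAt
            (isOpen_Ioo.mem_nhds (hsub' hx)))
          (fun x hx => (hy1.differentiableOn (by norm_num)).differentiableAt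
            (isOpen_Ioo.mem_nhds (hsub' hx)))
          (fun x hx => hyeq x (hsub' hx)) hy0 hy'0 (hvt t)
          (hvtt.comp (by fun_prop : Continuous fun x : ℝ => (x, t)))
          (fun x hx => hweq x hx t ht) ?_
        filter_upwards [lt_mem_nhds hSδ] with x hx
        exact hfront x t (by linarith [le_abs_self x, ht.2])

/-- The identity underlying the Krein equations of the Boundary Control method:
for the solution `y` of `−y'' + q y = 0`, `y(0) = 0`, `y'(0) = 1`, and a wave
`v` (with branches `vP` on `{x ≥ 0}` and `vM` on `{x ≤ 0}`) generated by the
control `(g₁, g₂)` acting at the origin,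
`∫_{−T}^T y(x) v(x,T) dx = ∫_0^T (T−t) g₁(t) dt`. -/
theorem stmt18 (T : ℝ) (hT : 0 < T)
    (q : ℝ → ℝ) (hq : ContinuousOn q (Icc (-T) T))
    (y : ℝ → ℝ) (hy : ContDiffOn ℝ 2 y (Icc (-T) T))
    (hyeq : ∀ x ∈ Ioo (-T) T, -(deriv (deriv y) x) + q x * y x = 0)
    (hy0 : y 0 = 0) (hy'0 : deriv y 0 = 1)
    (g₁ g₂ : ℝ → ℝ)
    (hg₁ : ContDiff ℝ (⊤ : ℕ∞) g₁) (hg₂ : ContDiff ℝ (⊤ : ℕ∞) g₂)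
    (hg₁supp : tsupport g₁ ⊆ Ioo 0 T) (hg₂supp : tsupport g₂ ⊆ Ioo 0 T)
    (vP vM : ℝ → ℝ → ℝ)
    (hvP : ContDiff ℝ 2 (Function.uncurry vP))
    (hvM : ContDiff ℝ 2 (Function.uncurry vM))
    -- the wave equation `v_tt − v_xx + q v = 0` away from the origin
    (hweqP : ∀ x : ℝ, 0 < x → ∀ t ∈ Icc (0:ℝ) T,
      deriv (deriv (vP x)) t
        - deriv (fun ξ => deriv (fun ζ => vP ζ t) ξ) x + q x * vP x t = 0)
    (hweqM : ∀ x : ℝ, x < 0 → ∀ t ∈ Icc (0:ℝ) T,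
      deriv (deriv (vM x)) t
        - deriv (fun ξ => deriv (fun ζ => vM ζ t) ξ) x + q x * vM x t = 0)
    -- finite propagation speed: `v(x,t) = 0` whenever `|x| ≥ t − δ`
    (δ : ℝ) (hδ : 0 < δ)
    (hfront : ∀ x t : ℝ, t - δ ≤ |x| → vP x t = 0 ∧ vM x t = 0)
    -- zero initial data
    (hinit : ∀ x : ℝ, vP x 0 = 0 ∧ vM x 0 = 0 ∧
      deriv (vP x) 0 = 0 ∧ deriv (vM x) 0 = 0)
    -- the jump conditions at the origin: `Γ₀v(·,t) = (g₁(t), g₂'(t))`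
    (hjump : ∀ t ∈ Ioo (0:ℝ) T,
      vP 0 t - vM 0 t = g₁ t ∧
      deriv (fun ξ => vP ξ t) 0 - deriv (fun ξ => vM ξ t) 0 = deriv g₂ t) :
    ((∫ x in (-T)..(0:ℝ), y x * vM x T) + ∫ x in (0:ℝ)..T, y x * vP x T)
      = ∫ t in (0:ℝ)..T, (T - t) * g₁ t := by
  have hright := integral_mul_wave_halfline hT hy hyeq hy0 hy'0 hvP hweqP hδ
    (fun x t h => (hfront x t h).1) (fun x => ⟨(hinit x).1, (hinit x).2.2.1⟩)
  have hderiv : deriv (fun x => -y (-x)) = fun x => deriv y (-x) := by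
    ext x
    rw [deriv.fun_neg, deriv_comp_neg, neg_neg]
  have hleft : ∫ x in (0:ℝ)..T, -y (-x) * vM (-x) T = ∫ t in (0:ℝ)..T, (T - t) * vM (-0) t := by
    refine integral_mul_wave_halfline (q := fun x => q (-x)) (y := fun x => -y (-x))
      (v := fun x => vM (-x)) hT ?_ ?_ ?_ ?_ ?_ ?_ hδ ?_ ?_
    · refine (hy.comp contDiff_neg.contDiffOn fun x hx => ?_).neg
      exact ⟨by linarith [hx.2], by linarith [hx.1]⟩
    · intro x hx
      have := hyeq (-x) ⟨by linarith [hx.2], by linarith [hx.1]⟩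
      rw [hderiv, deriv_comp_neg]
      linear_combination -this
    · simp [hy0]
    · simp [hderiv, hy'0]
    · exact hvM.comp (contDiff_fst.neg.prodMk contDiff_snd)
    · intro x hx t ht
      have := hweqM (-x) (by linarith) t ht
      have h1 : (fun ξ => deriv (fun ζ => vM (-ζ) t) ξ) =
          fun ξ => -deriv (fun ζ => vM ζ t) (-ξ) := by
        ext ξ
        exact deriv_comp_neg (f := fun ζ => vM ζ t) ξ
      rw [h1, deriv.fun_neg, deriv_comp_neg (f := fun ξ => deriv (fun ζ => vM ζ t) ξ), neg_neg]
      exact this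
    · exact fun x t h => (hfront (-x) t (by rwa [abs_neg])).2
    · exact fun x => ⟨(hinit (-x)).2.1, (hinit (-x)).2.2.2⟩
  have hreflect : ∫ x in (-T)..(0:ℝ), y x * vM x T = -∫ t in (0:ℝ)..T, (T - t) * vM 0 t := by
    rw [neg_zero] at hleft
    rw [← hleft, ← integral_neg]
    have := integral_comp_neg (a := 0) (b := T) (fun x => y x * vM x T)
    rw [neg_zero] at this
    simp only [← this, neg_mul, neg_neg]
  have hcP : Continuous (vP 0) := hvP.continuous.comp (Continuous.prodMk_right (0:ℝ))
  have hcM : Continuous (vM 0) := hvM.continuous.comp (Continuous.prodMk_right (0:ℝ))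
  rw [hright, hreflect, neg_add_eq_sub, ← integral_sub
    (Continuous.intervalIntegrable (by fun_prop) _ _)
    (Continuous.intervalIntegrable (by fun_prop) _ _)]
  refine integral_congr_Ioo_of_le hT.le fun t ht => ?_
  simp only [← mul_sub, (hjump t ht).1]
end
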